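/- Let n ≥ 3 be an integer, n − 1 < β < α ≤ ⌈α⌉ = n, a > 0, and let f : ℝ → ℝ, q : [0,∞) → ℝ, g : [0,∞) → ℝ be continuous satisfying (G1) x·f(x) > 0 for all x ≠ 0, (G2) there exist c_1, η > 0 with |f(x)| ≥ c_1|x|^η for all |x| ≥ 1, (H) there exist T_1 > 0 and c_3 > 0 with q(t) ≥ c_3 for all t ≥ T_1, and (K) there exist σ ∈ (n−β,1), c_4 > 0 and T_2 > 0 with g(t) ≥ c_4 t^{n−β−σ} for all t ≥ T_2. Let x be an eventually positive solution on [0,∞) of (^C D^α_{0^+} x)(t) + a·(^C D^β_{0^+} x)(t) + q(t)·f(x(t)) + sgn(x(t))·g(t) = 0, t > 0, with x(0) = x_0, x^{(i)}(0) = x_i for i = 1,…,n−1, and let y_1,…,y_n be the associated functions. Then: (i) if n is odd, there is T > 0 such that (−1)^{i+1} y_i(t) > 0 for all t ≥ T and all i = 1,…,n; (ii) if n is even, there is T > 0 such that either (−1)^i y_i(t) > 0 for all t ≥ T and all i = 1,…,n, or y_1(t) > 0, y_2(t) > 0 and (−1)^i y_i(t) > 0 for i = 3,…,n, for all t ≥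 T. -/

import Mathlib

open MeasureTheory Filter Set

noncomputable def fracInt (γ : ℝ) (f : ℝ → ℝ) (t : ℝ) : ℝ :=
  (1 / Real.Gamma γ) * ∫ s in (0:ℝ)..t, (t - s) ^ (γ - 1) * f s

noncomputable def taylorPolyAt0 (n : ℕ) (f : ℝ → ℝ) (t : ℝ) : ℝ :=
  ∑ k ∈ Finset.range n, iteratedDeriv k f 0 / (Nat.factorial k : ℝ) * t ^ k

noncomputable def caputoD (γ : ℝ) (f : ℝ → ℝ) : ℝ → ℝ :=
  iteratedDeriv ⌈γ⌉₊
    (fun t => fracInt ((⌈γ⌉₊ : ℝ) - γ) (fun s => f s - taylorPolyAt0 ⌈γ⌉₊ f s) t)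

def ContCaputoDiffOnIci (γ : ℝ) (f : ℝ → ℝ) : Prop :=
  ContDiffOn ℝ (⌈γ⌉₊ - 1 : ℕ) f (Set.Ici 0) ∧ ContinuousOn (caputoD γ f) (Set.Ici 0)

def Oscillatory (x : ℝ → ℝ) : Prop :=
  ∃ u : ℕ → ℝ, (∀ n, 0 ≤ u n) ∧ Filter.Tendsto u Filter.atTop Filter.atTop ∧ ∀ n, x (u n) = 0

noncomputable def assocY (n : ℕ) (α β a : ℝ) (ξ : ℕ → ℝ) (x : ℝ → ℝ) : ℕ → ℝ → ℝ
  | 1 => fun t => fracInt ((n : ℝ) - α) x t + a * fracInt ((n : ℝ) - β) x t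
  | 2 => fun t => caputoD (α - n + 1) x t + a * caputoD (β - n + 1) x t
      + ξ 0 * t ^ ((n : ℝ) - α - 1) / Real.Gamma ((n : ℝ) - α)
      + a * ξ 0 * t ^ ((n : ℝ) - β - 1) / Real.Gamma ((n : ℝ) - β)
  | i => fun t => caputoD (α - n - 1 + i) x t + a * caputoD (β - n - 1 + i) x t
      + (∑ k ∈ Finset.range (i - 1), ξ k *
          (∏ j ∈ Finset.range (i - 1 - k), ((n : ℝ) - α - i + 2 + k + j)) *
          t ^ ((n : ℝ) - α - i + 1 + k) / Real.Gamma ((n : ℝ) - α + 1))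
      + (∑ k ∈ Finset.range (i - 1), a * ξ k *
          (∏ j ∈ Finset.range (i - 1 - k), ((n : ℝ) - β - i + 2 + k + j)) *
          t ^ ((n : ℝ) - β - i + 1 + k) / Real.Gamma ((n : ℝ) - β + 1))

def AbsContOnInterval (f : ℝ → ℝ) (A B : ℝ) : Prop :=
  ∀ ε > (0:ℝ), ∃ δ > (0:ℝ), ∀ m : ℕ, ∀ s t : ℕ → ℝ,
    (∀ i < m, A ≤ s i ∧ s i ≤ t i ∧ t i ≤ B) →
    (∀ i < m, ∀ j < m, i ≠ j → Disjoint (Set.Ioo (s i) (t i)) (Set.Ioo (s j) (t j))) →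
    (∑ i ∈ Finset.range m, (t i - s i)) < δ →
    (∑ i ∈ Finset.range m, |f (t i) - f (s i)|) < ε

open scoped Topology

lemma integral_rpow_mul_rpow {a b r t : ℝ} (ha : 0 < a) (hb : 0 < b) (hrt : r < t) :
    ∫ s in r..t, (t - s) ^ (a - 1) * (s - r) ^ (b - 1)
      = Real.Gamma a * Real.Gamma b / Real.Gamma (a + b) * (t - r) ^ (a + b - 1) := by
  have hpos : 0 < t - r := sub_pos.2 hrt
  have h1 : ∫ s in r..t, (t - s) ^ (a - 1) * (s - r) ^ (b - 1)
      = ∫ s in (0:ℝ)..(t - r), s ^ (b - 1) * ((t - r) - s) ^ (a - 1) := by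
    have := intervalIntegral.integral_comp_sub_right
      (fun s : ℝ => s ^ (b - 1) * ((t - r) - s) ^ (a - 1)) r (a := r) (b := t)
    rw [sub_self] at this
    rw [← this]
    refine intervalIntegral.integral_congr fun s _ => ?_
    simp only [sub_sub_sub_cancel_right]
    ring
  rw [h1]
  have h2 := Complex.betaIntegral_scaled (b : ℂ) (a : ℂ) hpos
  rw [Complex.betaIntegral_eq_Gamma_mul_div _ _ (by simpa using hb) (by simpa using ha)] at h2
  have h3 : ∫ x in (0:ℝ)..(t - r),
      (x : ℂ) ^ ((b : ℂ) - 1) * (((t - r : ℝ) : ℂ) - (x : ℂ)) ^ ((a : ℂ) - 1)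
      = ((∫ s in (0:ℝ)..(t - r), s ^ (b - 1) * ((t - r) - s) ^ (a - 1) : ℝ) : ℂ) := by
    rw [← intervalIntegral.integral_ofReal]
    refine intervalIntegral.integral_congr fun s hs => ?_
    rw [uIcc_of_le hpos.le] at hs
    simp only [Complex.ofReal_mul]
    rw [Complex.ofReal_cpow hs.1, Complex.ofReal_cpow (sub_nonneg.2 hs.2)]
    push_cast
    rfl
  rw [h3] at h2
  have h4 : (((t - r : ℝ) : ℂ)) ^ ((b : ℂ) + a - 1) = (((t - r) ^ (a + b - 1) : ℝ) : ℂ) := by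
    rw [Complex.ofReal_cpow hpos.le]
    push_cast
    ring_nf
  rw [h4, ← Complex.ofReal_add, Complex.Gamma_ofReal, Complex.Gamma_ofReal,
    Complex.Gamma_ofReal] at h2
  have h5 := Complex.ofReal_injective (by rw [h2]; push_cast; rfl :
    ((∫ s in (0:ℝ)..(t - r), s ^ (b - 1) * ((t - r) - s) ^ (a - 1) : ℝ) : ℂ)
      = (((t - r) ^ (a + b - 1) * (Real.Gamma b * Real.Gamma a / Real.Gamma (b + a)) : ℝ) : ℂ))
  rw [h5, add_comm b a]
  ring

lemma intervalIntegrable_sub_rpow {γ c t : ℝ} (hγ : 0 < γ) :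
    IntervalIntegrable (fun s => (t - s) ^ (γ - 1)) volume c t := by
  have h := (intervalIntegral.intervalIntegrable_rpow' (a := 0) (b := t - c)
    (r := γ - 1) (by linarith)).comp_sub_left t
  simp only [sub_zero, sub_sub_cancel] at h
  exact h.symm

lemma integral_sub_rpow {γ c t : ℝ} (hγ : 0 < γ) :
    ∫ s in c..t, (t - s) ^ (γ - 1) = (t - c) ^ γ / γ := by
  have := intervalIntegral.integral_comp_sub_left (fun s : ℝ => s ^ (γ - 1)) t (a := c) (b := t)
  rw [this, sub_self, integral_rpow (Or.inl (by linarith))]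
  simp [Real.zero_rpow hγ.ne']

lemma intervalIntegrable_kernel_mul {γ c t : ℝ} {f : ℝ → ℝ} (hγ : 0 < γ)
    (hf : ContinuousOn f (uIcc c t)) :
    IntervalIntegrable (fun s => (t - s) ^ (γ - 1) * f s) volume c t :=
  (intervalIntegrable_sub_rpow hγ).mul_continuousOn hf

lemma fracInt_congr {γ t : ℝ} {f g : ℝ → ℝ} (ht : 0 ≤ t) (h : ∀ s ∈ Icc 0 t, f s = g s) :
    fracInt γ f t = fracInt γ g t := by
  unfold fracInt
  congr 1
  refine intervalIntegral.integral_congr fun s hs => ?_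
  rw [uIcc_of_le ht] at hs
  simp only [h s hs]

lemma continuous_comp_max {f : ℝ → ℝ} (hf : ContinuousOn f (Ici 0)) :
    Continuous fun s => f (max s 0) :=
  hf.comp_continuous (by fun_prop) fun s => mem_Ici.2 (le_max_right s 0)

lemma fracInt_comp_max {γ t : ℝ} {f : ℝ → ℝ} (ht : 0 ≤ t) :
    fracInt γ (fun s => f (max s 0)) t = fracInt γ f t :=
  fracInt_congr ht fun s hs => by rw [max_eq_left hs.1]

lemma fracInt_add {γ t : ℝ} {f g : ℝ → ℝ} (hγ : 0 < γ) (ht : 0 ≤ t)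
    (hf : ContinuousOn f (Ici 0)) (hg : ContinuousOn g (Ici 0)) :
    fracInt γ (fun s => f s + g s) t = fracInt γ f t + fracInt γ g t := by
  have hs : uIcc 0 t ⊆ Ici 0 := by rw [uIcc_of_le ht]; exact fun s hs => hs.1
  unfold fracInt
  rw [← mul_add, ← intervalIntegral.integral_add
    (intervalIntegrable_kernel_mul hγ (hf.mono hs)) (intervalIntegrable_kernel_mul hγ (hg.mono hs))]
  simp only [mul_add]

lemma fracInt_const {γ t c : ℝ} (hγ : 0 < γ) :
    fracInt γ (fun _ => c) t = c * t ^ γ / Real.Gamma (γ + 1) := by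
  unfold fracInt
  rw [intervalIntegral.integral_mul_const, integral_sub_rpow hγ, Real.Gamma_add_one hγ.ne']
  have := (Real.Gamma_pos_of_pos hγ).ne'
  rw [sub_zero]
  field_simp

lemma fracInt_rpow {γ r t : ℝ} (hγ : 0 < γ) (hr : -1 < r) (ht : 0 < t) :
    fracInt γ (fun s => s ^ r) t
      = Real.Gamma (r + 1) / Real.Gamma (γ + r + 1) * t ^ (γ + r) := by
  have h := integral_rpow_mul_rpow hγ (by linarith : 0 < r + 1) ht
  simp only [sub_zero, add_sub_cancel_right] at h
  unfold fracInt
  rw [h]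
  have := (Real.Gamma_pos_of_pos hγ).ne'
  rw [show γ + (r + 1) - 1 = γ + r by ring, ← add_assoc]
  field_simp

lemma fracInt_one {t : ℝ} {f : ℝ → ℝ} : fracInt 1 f t = ∫ s in (0:ℝ)..t, f s := by
  simp [fracInt]

lemma fracInt_eq_rescaled {γ t : ℝ} {f : ℝ → ℝ} (ht : 0 < t) :
    fracInt γ f t
      = 1 / Real.Gamma γ * (t ^ γ * ∫ s in (0:ℝ)..1, (1 - s) ^ (γ - 1) * f (t * s)) := by
  unfold fracInt
  congr 1
  have := intervalIntegral.mul_integral_comp_mul_left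
    (f := fun s => (t - s) ^ (γ - 1) * f s) (a := 0) (b := 1) t
  rw [mul_zero, mul_one] at this
  rw [← this, ← intervalIntegral.integral_const_mul, ← intervalIntegral.integral_const_mul]
  refine intervalIntegral.integral_congr fun s hs => ?_
  rw [uIcc_of_le zero_le_one] at hs
  rw [show t - t * s = t * (1 - s) by ring, Real.mul_rpow ht.le (by linarith [hs.2]),
    Real.rpow_sub_one ht.ne']
  field_simp

lemma continuousOn_fracInt {γ : ℝ} {f : ℝ → ℝ} (hγ : 0 < γ) (hf : ContinuousOn f (Ici 0)) :
    ContinuousOn (fracInt γ f) (Ici 0) := by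
  set g : ℝ → ℝ := fun s => f (max s 0) with hg
  have hgc : Continuous g := continuous_comp_max hf
  have key : Continuous fun t : ℝ =>
      t ^ γ * ∫ s in (0:ℝ)..1, (1 - s) ^ (γ - 1) * g (t * s) := by
    refine (Real.continuous_rpow_const hγ.le).mul ?_
    rw [continuous_iff_continuousAt]
    intro t₀
    obtain ⟨M, hM⟩ := (isCompact_Icc (a := -(|t₀| + 1)) (b := |t₀| + 1)).exists_bound_of_continuousOn
      hgc.continuousOn
    refine intervalIntegral.continuousAt_of_dominated_interval
      (bound := fun s => (1 - s) ^ (γ - 1) * M) ?_ ?_ ?_ ?_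
    · refine Eventually.of_forall fun t => ?_
      have : Measurable fun s : ℝ => (1 - s) ^ (γ - 1) * g (t * s) := by
        have := hgc.measurable
        fun_prop
      exact this.aestronglyMeasurable
    · filter_upwards [Metric.ball_mem_nhds t₀ one_pos] with t ht
      refine Eventually.of_forall fun s hs => ?_
      rw [uIoc_of_le zero_le_one] at hs
      rw [norm_mul, Real.norm_of_nonneg (Real.rpow_nonneg (by linarith [hs.2]) _)]
      refine mul_le_mul_of_nonneg_left (hM _ ?_) (Real.rpow_nonneg (by linarith [hs.2]) _)
      rw [mem_Icc, ← abs_le, abs_mul, abs_of_pos hs.1]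
      have h1 : |t| ≤ |t₀| + 1 := by
        have := abs_sub_abs_le_abs_sub t t₀
        rw [Metric.mem_ball, Real.dist_eq] at ht
        linarith
      nlinarith [abs_nonneg t, hs.1, hs.2]
    · exact (intervalIntegrable_sub_rpow hγ).mul_const _
    · refine Eventually.of_forall fun s _ => ?_
      fun_prop
  have key2 : Continuous fun t : ℝ =>
      (1 / Real.Gamma γ) * (t ^ γ * ∫ s in (0:ℝ)..1, (1 - s) ^ (γ - 1) * g (t * s)) :=
    continuous_const.mul key
  refine key2.continuousOn.congr fun t ht => ?_
  rw [← fracInt_comp_max ht]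
  rcases eq_or_lt_of_le (show (0:ℝ) ≤ t from ht) with h0 | h0
  · subst h0
    simp [fracInt, Real.zero_rpow hγ.ne']
  · exact fracInt_eq_rescaled h0

lemma integrable_triangle_kernel {a b t : ℝ} {g : ℝ → ℝ} (ha : 0 < a) (hb : 0 < b)
    (hg : Continuous g) :
    Integrable (fun z : ℝ × ℝ =>
      if z.2 < z.1 then (t - z.1) ^ (a - 1) * ((z.1 - z.2) ^ (b - 1) * g z.2) else 0)
      ((volume.restrict (Ioc 0 t)).prod (volume.restrict (Ioc 0 t))) := by
  have hgm := hg.measurable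
  obtain ⟨M, hM⟩ := (isCompact_Icc (a := 0) (b := t)).exists_bound_of_continuousOn hg.continuousOn
  have hmeas : Measurable (fun z : ℝ × ℝ =>
      if z.2 < z.1 then (t - z.1) ^ (a - 1) * ((z.1 - z.2) ^ (b - 1) * g z.2) else 0) :=
    Measurable.ite (measurableSet_lt measurable_snd measurable_fst) (by fun_prop) measurable_const
  have hind : ∀ s, (fun r => if r < s then (t - s) ^ (a - 1) * ((s - r) ^ (b - 1) * g r) else 0)
      = (Iio s).indicator fun r => (t - s) ^ (a - 1) * ((s - r) ^ (b - 1) * g r) := by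
    intro s; ext r; simp [indicator]
  have hset : ∀ s ∈ Ioc 0 t, (Iio s ∩ Ioc 0 t : Set ℝ) = Ioo 0 s := by
    intro s hs; ext r
    simp only [mem_inter_iff, mem_Iio, mem_Ioc, mem_Ioo]
    exact ⟨fun h => ⟨h.2.1, h.1⟩, fun h => ⟨h.2, h.1, (h.2.trans_le hs.2).le⟩⟩
  have hint : ∀ s ∈ Ioc 0 t, IntegrableOn (fun r => (s - r) ^ (b - 1) * g r) (Ioo 0 s) := by
    intro s hs
    have := (intervalIntegrable_kernel_mul (c := 0) (t := s) hb hg.continuousOn)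
    rw [intervalIntegrable_iff_integrableOn_Ioo_of_le hs.1.le] at this
    exact this
  rw [integrable_prod_iff hmeas.aestronglyMeasurable]
  constructor
  · refine (ae_restrict_iff' measurableSet_Ioc).2 (Eventually.of_forall fun s hs => ?_)
    simp only
    rw [hind, integrable_indicator_iff measurableSet_Iio, IntegrableOn,
      Measure.restrict_restrict measurableSet_Iio, hset s hs]
    exact (hint s hs).const_mul _
  · have hbound : IntegrableOn (fun s => (t - s) ^ (a - 1) * (M * (t ^ b / b))) (Ioc 0 t) := by
      rcases le_total 0 t with ht | ht
      · exact (intervalIntegrable_iff_integrableOn_Ioc_of_le ht).1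
          ((intervalIntegrable_sub_rpow ha).mul_const _)
      · rw [Ioc_eq_empty (not_lt.2 ht)]; exact integrableOn_empty
    refine Integrable.mono' hbound ?_ ?_
    · exact hmeas.norm.aestronglyMeasurable.integral_prod_right'
    · refine (ae_restrict_iff' measurableSet_Ioc).2 (Eventually.of_forall fun s hs => ?_)
      have hts : 0 ≤ (t - s) ^ (a - 1) := Real.rpow_nonneg (by linarith [hs.2]) _
      rw [Real.norm_of_nonneg (integral_nonneg fun _ => norm_nonneg _)]
      have e1 : (∫ r in Ioc 0 t, ‖if r < s then (t - s) ^ (a - 1) * ((s - r) ^ (b - 1) * g r) else 0‖)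
          = ∫ r in Ioo 0 s, (t - s) ^ (a - 1) * ‖(s - r) ^ (b - 1) * g r‖ := by
        rw [← hset s hs, ← Measure.restrict_restrict measurableSet_Iio,
          ← integral_indicator measurableSet_Iio]
        congr 1
        ext r
        by_cases h : r < s
        · simp only [h, if_true, indicator, mem_Iio]
          rw [norm_mul, Real.norm_of_nonneg hts]
        · simp [h, indicator]
      rw [e1, integral_const_mul]
      refine mul_le_mul_of_nonneg_left ?_ hts
      have hMnn : 0 ≤ M := (norm_nonneg _).trans (hM s ⟨hs.1.le, hs.2⟩)
      have e2 : ∫ r in Ioo 0 s, ‖(s - r) ^ (b - 1) * g r‖ ≤ ∫ r in Ioo 0 s, (s - r) ^ (b - 1) * M := by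
        have hi : IntegrableOn (fun r => (s - r) ^ (b - 1) * M) (Ioo 0 s) :=
          (intervalIntegrable_iff_integrableOn_Ioo_of_le hs.1.le).1
            ((intervalIntegrable_sub_rpow hb).mul_const _)
        refine setIntegral_mono_on (hint s hs).norm hi measurableSet_Ioo fun r hr => ?_
        have hsr : 0 ≤ (s - r) ^ (b - 1) := Real.rpow_nonneg (by linarith [hr.2]) _
        rw [norm_mul, Real.norm_of_nonneg hsr]
        exact mul_le_mul_of_nonneg_left (hM r ⟨hr.1.le, (hr.2.trans_le hs.2).le⟩) hsr
      refine e2.trans ?_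
      rw [integral_mul_const, ← integral_Ioc_eq_integral_Ioo,
        ← intervalIntegral.integral_of_le hs.1.le, integral_sub_rpow hb, mul_comm, sub_zero]
      gcongr
      · exact hs.1.le
      · exact hs.2

lemma fracInt_fracInt {a b t : ℝ} {f : ℝ → ℝ} (ha : 0 < a) (hb : 0 < b) (ht : 0 ≤ t)
    (hf : ContinuousOn f (Ici 0)) :
    fracInt a (fracInt b f) t = fracInt (a + b) f t := by
  set g : ℝ → ℝ := fun s => f (max s 0) with hg
  have hgc : Continuous g := continuous_comp_max hf
  rw [fracInt_congr (γ := a) (g := fracInt b g) ht fun s hs => (fracInt_comp_max hs.1).symm,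
    ← fracInt_comp_max (f := f) ht]
  change fracInt a (fracInt b g) t = fracInt (a + b) g t
  have hGa := (Real.Gamma_pos_of_pos ha).ne'
  have hGb := (Real.Gamma_pos_of_pos hb).ne'
  have hGab := (Real.Gamma_pos_of_pos (add_pos ha hb)).ne'
  have swap := integral_integral_swap
    (f := fun s r : ℝ => if r < s then (t - s) ^ (a - 1) * ((s - r) ^ (b - 1) * g r) else 0)
    (integrable_triangle_kernel (t := t) ha hb hgc)
  have left : ∀ s ∈ Ioc 0 t,
      (∫ r in Ioc 0 t, if r < s then (t - s) ^ (a - 1) * ((s - r) ^ (b - 1) * g r) else 0)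
        = (t - s) ^ (a - 1) * (Real.Gamma b * fracInt b g s) := by
    intro s hs
    have hset : (Iio s ∩ Ioc 0 t : Set ℝ) = Ioo 0 s := by
      ext r
      simp only [mem_inter_iff, mem_Iio, mem_Ioc, mem_Ioo]
      exact ⟨fun h => ⟨h.2.1, h.1⟩, fun h => ⟨h.2, h.1, (h.2.trans_le hs.2).le⟩⟩
    have hind : (fun r => if r < s then (t - s) ^ (a - 1) * ((s - r) ^ (b - 1) * g r) else 0)
        = (Iio s).indicator fun r => (t - s) ^ (a - 1) * ((s - r) ^ (b - 1) * g r) := by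
      ext r; simp [indicator]
    rw [hind, integral_indicator measurableSet_Iio, Measure.restrict_restrict measurableSet_Iio,
      hset, integral_const_mul, ← integral_Ioc_eq_integral_Ioo,
      ← intervalIntegral.integral_of_le hs.1.le]
    unfold fracInt
    field_simp
  have right : ∀ r ∈ Ioc 0 t, r ≠ t →
      (∫ s in Ioc 0 t, if r < s then (t - s) ^ (a - 1) * ((s - r) ^ (b - 1) * g r) else 0)
        = Real.Gamma a * Real.Gamma b / Real.Gamma (a + b) * ((t - r) ^ (a + b - 1) * g r) := by
    intro r hr hrt
    have hset : (Ioi r ∩ Ioc 0 t : Set ℝ) = Ioc r t := by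
      ext s
      simp only [mem_inter_iff, mem_Ioi, mem_Ioc]
      exact ⟨fun h => ⟨h.1, h.2.2⟩, fun h => ⟨h.1, hr.1.trans h.1, h.2⟩⟩
    have hind : (fun s => if r < s then (t - s) ^ (a - 1) * ((s - r) ^ (b - 1) * g r) else 0)
        = (Ioi r).indicator fun s => (t - s) ^ (a - 1) * (s - r) ^ (b - 1) * g r := by
      ext s; simp [indicator, mul_assoc]
    rw [hind, integral_indicator measurableSet_Ioi, Measure.restrict_restrict measurableSet_Ioi,
      hset, ← intervalIntegral.integral_of_le hr.2, intervalIntegral.integral_mul_const,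
      integral_rpow_mul_rpow ha hb (lt_of_le_of_ne hr.2 hrt)]
    ring
  have hr := setIntegral_congr_ae (g := fun r => Real.Gamma a * Real.Gamma b / Real.Gamma (a + b) *
    ((t - r) ^ (a + b - 1) * g r)) measurableSet_Ioc
    (by filter_upwards [Measure.ae_ne volume t] with r h1 h2 using right r h2 h1)
  rw [setIntegral_congr_fun measurableSet_Ioc left, hr,
    ← intervalIntegral.integral_of_le ht, ← intervalIntegral.integral_of_le ht,
    intervalIntegral.integral_const_mul] at swap
  have e : ∫ s in (0:ℝ)..t, (t - s) ^ (a - 1) * (Real.Gamma b * fracInt b g s)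
      = Real.Gamma b * ∫ s in (0:ℝ)..t, (t - s) ^ (a - 1) * fracInt b g s := by
    rw [← intervalIntegral.integral_const_mul]
    refine intervalIntegral.integral_congr fun s _ => ?_
    ring
  rw [e] at swap
  have e2 : ∫ s in (0:ℝ)..t, (t - s) ^ (a - 1) * fracInt b g s = Real.Gamma a / Real.Gamma (a + b) *
      ∫ s in (0:ℝ)..t, (t - s) ^ (a + b - 1) * g s := by
    refine mul_left_cancel₀ hGb (swap.trans ?_)
    ring
  change 1 / Real.Gamma a * (∫ s in (0:ℝ)..t, (t - s) ^ (a - 1) * fracInt b g s) = _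
  rw [e2]
  unfold fracInt
  field_simp

lemma hasDerivAt_integral_of_continuousOn_Ici {f : ℝ → ℝ} (hf : ContinuousOn f (Ici 0)) {t : ℝ}
    (ht : 0 < t) : HasDerivAt (fun t => ∫ s in (0:ℝ)..t, f s) (f t) t := by
  refine intervalIntegral.integral_hasDerivAt_right ?_ ?_ (hf.continuousAt (Ici_mem_nhds ht))
  · refine (hf.mono ?_).intervalIntegrable
    rw [uIcc_of_le ht.le]
    exact fun s hs => hs.1
  · exact (hf.mono Ioi_subset_Ici_self).stronglyMeasurableAtFilter isOpen_Ioi t ht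

lemma hasDerivAt_fracInt {γ t : ℝ} {f f' : ℝ → ℝ} (hγ : 0 < γ) (hf : ContinuousOn f (Ici 0))
    (hf' : ContinuousOn f' (Ici 0)) (hd : ∀ s > 0, HasDerivAt f (f' s) s) (ht : 0 < t) :
    HasDerivAt (fracInt γ f) (f 0 / Real.Gamma γ * t ^ (γ - 1) + fracInt γ f' t) t := by
  have hprim : ∀ s ≥ 0, f s = f 0 + fracInt 1 f' s := by
    intro s hs
    rw [fracInt_one, intervalIntegral.integral_eq_sub_of_hasDerivAt_of_le hs
      (hf.mono fun r hr => hr.1) (fun r hr => hd r hr.1)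
      ((hf'.mono (by rw [uIcc_of_le hs]; exact fun r hr => hr.1)).intervalIntegrable)]
    ring
  have heq : ∀ s ≥ 0, fracInt γ f s
      = f 0 * s ^ γ / Real.Gamma (γ + 1) + ∫ r in (0:ℝ)..s, fracInt γ f' r := by
    intro s hs
    rw [fracInt_congr hs fun r hr => hprim r hr.1,
      fracInt_add hγ hs continuousOn_const (continuousOn_fracInt one_pos hf'), fracInt_const hγ,
      fracInt_fracInt hγ one_pos hs hf', add_comm γ 1, ← fracInt_fracInt one_pos hγ hs hf',
      fracInt_one]
  have h1 := (((Real.hasDerivAt_rpow_const (x := t) (p := γ) (Or.inl ht.ne')).const_mul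
    (f 0)).div_const (Real.Gamma (γ + 1))).add
    (hasDerivAt_integral_of_continuousOn_Ici (continuousOn_fracInt hγ hf') ht)
  refine (h1.congr_of_eventuallyEq ?_).congr_deriv ?_
  · filter_upwards [Ioi_mem_nhds ht] with s hs using heq s (le_of_lt hs)
  · rw [Real.Gamma_add_one hγ.ne']
    have := (Real.Gamma_pos_of_pos hγ).ne'
    field_simp

lemma monotoneOn_fracInt {γ L : ℝ} {f : ℝ → ℝ} (hγ : 0 < γ) (hf : ContinuousOn f (Ici 0))
    (h0 : 0 ≤ f 0) (hmono : MonotoneOn f (Icc 0 L)) : MonotoneOn (fracInt γ f) (Ioc 0 L) := by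
  have hGam := Real.Gamma_pos_of_pos hγ
  intro t₁ h₁ t₂ h₂ h12
  have hmem : ∀ t ∈ Ioc 0 L, ∀ s ∈ Icc (0:ℝ) 1, t * s ∈ Icc 0 L := fun t ht s hs =>
    ⟨mul_nonneg ht.1.le hs.1, (mul_le_of_le_one_right ht.1.le hs.2).trans ht.2⟩
  have hnonneg : ∀ s ∈ Icc 0 L, 0 ≤ f s := fun s hs =>
    h0.trans (hmono ⟨le_rfl, hs.1.trans hs.2⟩ hs hs.1)
  have hint : ∀ t ∈ Ioc 0 L,
      IntervalIntegrable (fun s => (1 - s) ^ (γ - 1) * f (t * s)) volume 0 1 := fun t ht =>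
    intervalIntegrable_kernel_mul (f := fun s => f (t * s)) hγ
      (hf.comp (by fun_prop) fun s hs => by
        rw [uIcc_of_le zero_le_one] at hs
        exact (hmem t ht s hs).1)
  have hker : ∀ s ∈ Icc (0:ℝ) 1, 0 ≤ (1 - s) ^ (γ - 1) := fun s hs =>
    Real.rpow_nonneg (by linarith [hs.2]) _
  rw [fracInt_eq_rescaled h₁.1, fracInt_eq_rescaled h₂.1]
  refine mul_le_mul_of_nonneg_left ?_ (by positivity)
  refine mul_le_mul (Real.rpow_le_rpow h₁.1.le h12 hγ.le) ?_ ?_ (Real.rpow_nonneg h₂.1.le _)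
  · exact intervalIntegral.integral_mono_on zero_le_one (hint t₁ h₁) (hint t₂ h₂) fun s hs =>
      mul_le_mul_of_nonneg_left (hmono (hmem _ h₁ _ hs) (hmem _ h₂ _ hs)
        (mul_le_mul_of_nonneg_right h12 hs.1)) (hker s hs)
  · exact intervalIntegral.integral_nonneg zero_le_one fun s hs =>
      mul_nonneg (hker s hs) (hnonneg _ (hmem _ h₁ _ hs))

lemma fracInt_split {γ p t : ℝ} {f : ℝ → ℝ} (hp : 0 < p) (hpt : p ≤ t)
    (hint : IntervalIntegrable (fun s => (t - s) ^ (γ - 1) * f s) volume 0 t) :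
    fracInt γ f t = 1 / Real.Gamma γ * (∫ s in (0:ℝ)..p, (t - s) ^ (γ - 1) * f s)
      + fracInt γ (fun s => f (p + s)) (t - p) := by
  have hmem : p ∈ uIcc 0 t := by rw [uIcc_of_le (hp.le.trans hpt)]; exact ⟨hp.le, hpt⟩
  unfold fracInt
  rw [← mul_add]
  congr 1
  have h := intervalIntegral.integral_comp_add_left (fun s => (t - s) ^ (γ - 1) * f s) p
    (a := 0) (b := t - p)
  rw [add_zero, add_sub_cancel] at h
  simp only [← sub_sub] at h
  rw [h, intervalIntegral.integral_add_adjacent_intervals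
    (hint.mono_set (uIcc_subset_uIcc_left hmem)) (hint.mono_set (uIcc_subset_uIcc_right hmem))]

/-- A fractional integral of a nonnegative function cannot increase at a positive rate just before a
zero of that function. -/
lemma fracInt_not_increasing_before_zero {γ S p κ : ℝ} {z : ℝ → ℝ} (hγ : 0 < γ) (hγ1 : γ < 1)
    (hp : 0 < p) (hpS : p < S) (hκ : 0 < κ) (hz : ContinuousOn z (Ioi 0))
    (hint : ∀ t > 0, IntervalIntegrable (fun s => (t - s) ^ (γ - 1) * z s) volume 0 t)
    (hnonneg : ∀ s ∈ Ioc 0 S, 0 ≤ z s) (hzero : z S = 0)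
    (hincr : ∀ s t, p ≤ s → s ≤ t → t ≤ S → κ * (t - s) ≤ fracInt γ z t - fracInt γ z s) :
    False := by
  have hδ : 0 < 1 - γ := by linarith
  have hGam := Real.Gamma_pos_of_pos hγ
  set L := S - p with hL
  have hLpos : 0 < L := by rw [hL]; linarith
  set y : ℝ → ℝ := fun s => z (p + s) with hy
  have hyc : ContinuousOn y (Ici 0) := hz.comp (by fun_prop) fun s hs => by
    rw [mem_Ici] at hs; rw [mem_Ioi]; linarith
  have hJ := continuousOn_fracInt hγ hyc
  have hhist : ∀ s t, p ≤ s → s ≤ t →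
      ∫ r in (0:ℝ)..p, (t - r) ^ (γ - 1) * z r ≤ ∫ r in (0:ℝ)..p, (s - r) ^ (γ - 1) * z r := by
    intro s t hs hst
    have hi : ∀ t, p ≤ t → IntervalIntegrable (fun s => (t - s) ^ (γ - 1) * z s) volume 0 p :=
      fun t ht => (hint t (hp.trans_le ht)).mono_set (uIcc_subset_uIcc_left (by
        rw [uIcc_of_le (hp.le.trans ht)]; exact ⟨hp.le, ht⟩))
    refine intervalIntegral.integral_mono_on_of_le_Ioo hp.le (hi t (hs.trans hst)) (hi s hs)
      fun r hr => ?_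
    refine mul_le_mul_of_nonneg_right ?_ (hnonneg r ⟨hr.1, (hr.2.trans hpS).le⟩)
    exact Real.rpow_le_rpow_of_nonpos (by linarith [hr.2]) (by linarith) (by linarith)
  have hJincr : ∀ s t, 0 ≤ s → s ≤ t → t ≤ L → κ * (t - s) ≤ fracInt γ y t - fracInt γ y s := by
    intro s t hs hst ht
    have h1 := hincr (p + s) (p + t) (by linarith) (by linarith) (by linarith)
    rw [fracInt_split hp (by linarith) (hint (p + t) (by linarith)),
      fracInt_split hp (by linarith) (hint (p + s) (by linarith))] at h1
    rw [add_sub_cancel_left, add_sub_cancel_left, add_sub_add_left_eq_sub] at h1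
    have h2 := mul_le_mul_of_nonneg_left
      (hhist (p + s) (p + t) (by linarith) (by linarith)) (one_div_pos.2 hGam).le
    linarith
  set N : ℝ → ℝ := fun s => fracInt γ y s + -κ * s ^ (1:ℝ) with hN
  have hlin : ContinuousOn (fun s : ℝ => -κ * s ^ (1:ℝ)) (Ici 0) := by
    simp only [Real.rpow_one]; fun_prop
  have hNc : ContinuousOn N (Ici 0) := hJ.add hlin
  have hNmono : MonotoneOn N (Icc 0 L) := by
    intro s hs t ht hst
    have := hJincr s t hs.1 hst ht.2
    simp only [hN, Real.rpow_one]
    linarith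
  have hmono := monotoneOn_fracInt hδ hNc (by simp [hN, fracInt]) hNmono
  have hform : ∀ s > 0, fracInt (1 - γ) N s
      = (∫ r in (0:ℝ)..s, y r) - κ * (s ^ (2 - γ) / Real.Gamma (3 - γ)) := by
    intro s hs
    rw [hN, fracInt_add hδ hs.le hJ hlin, fracInt_fracInt hδ hγ hs.le hyc, sub_add_cancel,
      fracInt_one]
    have h1 := fracInt_rpow hδ (by norm_num : (-1:ℝ) < 1) hs
    have h2 : fracInt (1 - γ) (fun s => -κ * s ^ (1:ℝ)) s
        = -κ * fracInt (1 - γ) (fun s => s ^ (1:ℝ)) s := by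
      unfold fracInt
      simp only [mul_left_comm _ (-κ)]
      rw [intervalIntegral.integral_const_mul]
      ring
    rw [h2, h1, show (1:ℝ) + 1 = 2 by norm_num, Real.Gamma_two,
      show 1 - γ + 1 = 2 - γ by ring, show 2 - γ + 1 = 3 - γ by ring]
    ring
  have hder : HasDerivAt (fracInt (1 - γ) N)
      (y L - κ * (((2 - γ) * L ^ (2 - γ - 1)) / Real.Gamma (3 - γ))) L := by
    refine HasDerivAt.congr_of_eventuallyEq ?_
      (by filter_upwards [Ioi_mem_nhds hLpos] with s hs using hform s hs)
    exact (hasDerivAt_integral_of_continuousOn_Ici hyc hLpos).sub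
      (((Real.hasDerivAt_rpow_const (Or.inl hLpos.ne')).div_const _).const_mul _)
  have hge : 0 ≤ y L - κ * (((2 - γ) * L ^ (2 - γ - 1)) / Real.Gamma (3 - γ)) := by
    have hw := hder.hasDerivWithinAt (s := Iio L)
    rw [hasDerivWithinAt_iff_tendsto_slope' self_notMem_Iio] at hw
    refine ge_of_tendsto hw ?_
    filter_upwards [Ioo_mem_nhdsLT hLpos] with s hs
    rw [slope_def_field]
    exact div_nonneg_of_nonpos
      (by linarith [hmono ⟨hs.1, hs.2.le⟩ ⟨hLpos, le_rfl⟩ hs.2.le]) (by linarith [hs.2])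
  have hyL : y L = 0 := by simp [hy, hL, hzero]
  rw [hyL] at hge
  have : 0 < κ * (((2 - γ) * L ^ (2 - γ - 1)) / Real.Gamma (3 - γ)) := by
    have h1 : 0 < Real.Gamma (3 - γ) := Real.Gamma_pos_of_pos (by linarith)
    have h2 : 0 < L ^ (2 - γ - 1) := Real.rpow_pos_of_pos hLpos _
    have h3 : 0 < 2 - γ := by linarith
    positivity
  linarith

lemma hasDerivAt_integral_sub_rpow_mul {T t r : ℝ} {f : ℝ → ℝ} (hT : 0 ≤ T) (hTt : T < t)
    (hf : IntervalIntegrable f volume 0 T) :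
    HasDerivAt (fun t => ∫ s in (0:ℝ)..T, (t - s) ^ r * f s)
      (r * ∫ s in (0:ℝ)..T, (t - s) ^ (r - 1) * f s) t := by
  set ε := (t - T) / 2 with hε
  have hεpos : 0 < ε := by rw [hε]; linarith
  obtain ⟨M, hM⟩ := (isCompact_Icc (a := ε) (b := t + ε)).exists_bound_of_continuousOn
    (f := fun y : ℝ => y ^ (r - 1)) fun y hy =>
      (Real.continuousAt_rpow_const _ _ (Or.inl (by linarith [hy.1]))).continuousWithinAt
  have hcont : ∀ x > T, ∀ r : ℝ, ContinuousOn (fun s => (x - s) ^ r) (uIcc 0 T) := by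
    intro x hx r s hs
    rw [uIcc_of_le hT] at hs
    refine ContinuousAt.continuousWithinAt ?_
    exact ContinuousAt.rpow_const (by fun_prop) (Or.inl (by linarith [hs.2]))
  have hball : ∀ x ∈ Metric.ball t ε, T < x ∧ x < t + ε ∧ T + ε < x := by
    intro x hx
    rw [Metric.mem_ball, Real.dist_eq, abs_lt] at hx
    refine ⟨?_, ?_, ?_⟩ <;> linarith [hx.1, hx.2]
  have h := intervalIntegral.hasDerivAt_integral_of_dominated_loc_of_deriv_le
    (μ := volume) (a := 0) (b := T) (x₀ := t) (s := Metric.ball t ε)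
    (F := fun x s => (x - s) ^ r * f s) (F' := fun x s => r * (x - s) ^ (r - 1) * f s)
    (bound := fun s => |r| * M * ‖f s‖) (Metric.ball_mem_nhds t hεpos)
    (by
      filter_upwards [Metric.ball_mem_nhds t hεpos] with x hx
      exact ((hf.continuousOn_mul (hcont x (hball x hx).1 r)).def').aestronglyMeasurable)
    (hf.continuousOn_mul (hcont t hTt r))
    (by
      have := (hf.continuousOn_mul (hcont t hTt (r - 1))).const_mul r
      simp only [← mul_assoc] at this
      exact this.def'.aestronglyMeasurable)
    (by
      refine Eventually.of_forall fun s hs x hx => ?_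
      rw [uIoc_of_le hT] at hs
      have hx' := hball x hx
      rw [norm_mul, norm_mul, Real.norm_eq_abs r]
      gcongr
      exact hM _ ⟨by linarith [hs.2], by linarith [hs.1]⟩)
    (hf.norm.const_mul _)
    (by
      refine Eventually.of_forall fun s hs x hx => ?_
      rw [uIoc_of_le hT] at hs
      have hx' := hball x hx
      have h1 := ((hasDerivAt_id x).sub_const s).rpow_const (p := r)
        (Or.inl (by simp only [id]; linarith [hs.2]))
      simpa using h1.mul_const (f s))
  refine h.2.congr_deriv ?_
  rw [← intervalIntegral.integral_const_mul]
  simp only [mul_assoc]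

lemma abs_integral_sub_rpow_mul_le {T t r : ℝ} {f : ℝ → ℝ} (hT : 0 ≤ T) (hTt : T < t)
    (hr : r ≤ 0) (hf : IntervalIntegrable f volume 0 T) :
    |∫ s in (0:ℝ)..T, (t - s) ^ r * f s| ≤ (t - T) ^ r * ∫ s in (0:ℝ)..T, |f s| := by
  rw [← intervalIntegral.integral_const_mul]
  rw [← Real.norm_eq_abs]
  refine intervalIntegral.norm_integral_le_of_norm_le hT
    (Eventually.of_forall fun s hs => ?_) (hf.norm.const_mul _)
  have h1 : 0 < t - T := by linarith
  rw [norm_mul, Real.norm_of_nonneg (Real.rpow_nonneg (by linarith [hs.2]) _)]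
  exact mul_le_mul_of_nonneg_right
    (Real.rpow_le_rpow_of_nonpos h1 (by linarith [hs.2]) hr) (norm_nonneg _)

lemma differentiableAt_fracInt {γ t ε : ℝ} {f f' : ℝ → ℝ} (hγ : 0 < γ)
    (hf : ContinuousOn f (Ici 0)) (ht : 0 < t) (hε : 0 < ε)
    (hd : ∀ s ∈ Ioo (t - ε) (t + ε), HasDerivAt f (f' s) s)
    (hf' : ContinuousOn f' (Ioo (t - ε) (t + ε))) :
    DifferentiableAt ℝ (fracInt γ f) t := by
  obtain ⟨η, hη, hηε, hηt⟩ : ∃ η > 0, η < ε ∧ η < t :=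
    ⟨min ε t / 2, by positivity, by linarith [min_le_left ε t, lt_min hε ht],
      by linarith [min_le_right ε t, lt_min hε ht]⟩
  set p := t - η with hp
  have hp0 : 0 < p := by rw [hp]; linarith
  set g' : ℝ → ℝ := fun s => f' (p + max 0 (min s (2 * η))) with hg'
  have hmem : ∀ s, p + max 0 (min s (2 * η)) ∈ Ioo (t - ε) (t + ε) := by
    intro s
    have h1 : max 0 (min s (2 * η)) ≤ 2 * η := max_le (by linarith) (min_le_right _ _)
    have h2 : 0 ≤ max 0 (min s (2 * η)) := le_max_left _ _
    constructor <;> rw [hp] <;> linarith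
  have hg'c : Continuous g' := hf'.comp_continuous (by fun_prop) hmem
  set g : ℝ → ℝ := fun s => f p + ∫ r in (0:ℝ)..s, g' r with hg
  have hgd : ∀ s, HasDerivAt g (g' s) s := fun s =>
    (intervalIntegral.integral_hasDerivAt_right (hg'c.intervalIntegrable _ _)
      (hg'c.stronglyMeasurableAtFilter _ _) hg'c.continuousAt).const_add _
  have hgc : Continuous g := continuous_iff_continuousAt.2 fun s => (hgd s).continuousAt
  have hfg : ∀ s ∈ Icc 0 (2 * η), f (p + s) = g s := by
    intro s hs
    have hm : ∀ r ∈ Icc 0 s, p + r ∈ Ioo (t - ε) (t + ε) := fun r hr => by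
      constructor <;> rw [hp] <;> linarith [hr.1, hr.2, hs.2]
    have h1 : ∫ r in (0:ℝ)..s, g' r = f (p + s) - f (p + 0) := by
      refine intervalIntegral.integral_eq_sub_of_hasDerivAt (f := fun r => f (p + r)) ?_
        (hg'c.intervalIntegrable _ _)
      intro r hr
      rw [uIcc_of_le hs.1] at hr
      have h2 : g' r = f' (p + r) := by
        simp only [hg']
        rw [min_eq_left (hr.2.trans hs.2), max_eq_right hr.1]
      rw [h2]
      exact (hd _ (hm r hr)).comp_const_add p r
    simp only [hg]
    rw [h1, add_zero]
    ring
  have hfi : IntervalIntegrable f volume 0 p :=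
    (hf.mono (by rw [uIcc_of_le hp0.le]; exact fun s hs => hs.1)).intervalIntegrable
  have h1 := (hasDerivAt_integral_sub_rpow_mul (r := γ - 1) hp0.le
    (by rw [hp]; linarith : p < t) hfi).differentiableAt.const_mul (1 / Real.Gamma γ)
  have h2 : DifferentiableAt ℝ (fun x => fracInt γ g (x - p)) t :=
    ((hasDerivAt_fracInt (t := t - p) hγ hgc.continuousOn hg'c.continuousOn (fun s _ => hgd s)
      (by rw [hp]; linarith)).comp_sub_const t p).differentiableAt
  refine (h1.add h2).congr_of_eventuallyEq ?_
  filter_upwards [Ioo_mem_nhds (by rw [hp]; linarith : p < t) (by linarith : t < t + η)] with x hx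
  have hx0 : 0 < x := hp0.trans hx.1
  rw [fracInt_split hp0 hx.1.le (intervalIntegrable_kernel_mul hγ
    (hf.mono (by rw [uIcc_of_le hx0.le]; exact fun s hs => hs.1)))]
  simp only [Pi.add_apply]
  congr 1
  exact fracInt_congr (by linarith [hx.1]) fun s hs =>
    hfg s ⟨hs.1, hs.2.trans (by rw [hp]; linarith [hx.2])⟩

lemma exists_history_decomposition {δ T : ℝ} {f V : ℝ → ℝ} (hδ : 0 < δ) (hδ1 : δ < 1) (hT : 0 < T)
    (hf : ContinuousOn f (Ici 0)) (hV : ContinuousOn V (Ici 0))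
    (hd : ∀ s > 0, HasDerivAt (fracInt δ f) (V s) (T + s)) :
    ∃ H H' : ℝ → ℝ, (∀ s > 0, f (T + s) = H s + fracInt (1 - δ) V s) ∧
      (∀ s > 0, HasDerivAt H (H' s) s) ∧
      ∃ C, ∀ s ≥ 1, |H' s| ≤ C * s ^ (-δ - 1) := by
  set F := fracInt δ f with hF
  have hδ' : 0 < 1 - δ := by linarith
  have hFc : ContinuousOn F (Ici 0) := continuousOn_fracInt hδ hf
  have hFi : IntervalIntegrable F volume 0 T :=
    (hFc.mono (by rw [uIcc_of_le hT.le]; exact fun s hs => hs.1)).intervalIntegrable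
  set I : ℝ → ℝ → ℝ := fun r s => ∫ x in (0:ℝ)..T, (T + s - x) ^ r * F x with hI
  have hId : ∀ r, ∀ s > 0, HasDerivAt (I r) (r * I (r - 1) s) s := fun r s hs =>
    (hasDerivAt_integral_sub_rpow_mul (t := T + s) (r := r) hT.le (by linarith)
      hFi).comp_const_add T s
  set G := Real.Gamma (1 - δ) with hG
  refine ⟨fun s => 1 / G * (-δ * I (-δ - 1) s) + F T / G * s ^ (-δ),
    fun s => 1 / G * (-δ * ((-δ - 1) * I (-δ - 1 - 1) s)) + F T / G * (-δ * s ^ (-δ - 1)),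
    ?_, ?_, ?_⟩
  · intro s hs
    have h1 : HasDerivAt (fun s => ∫ x in (0:ℝ)..(T + s), f x) (f (T + s)) s :=
      (hasDerivAt_integral_of_continuousOn_Ici hf (by linarith : 0 < T + s)).comp_const_add T s
    have hshift : ContinuousOn (fun s => F (T + s)) (Ici 0) := hFc.comp (by fun_prop) fun r hr => by
      rw [mem_Ici] at hr ⊢; linarith
    have h2 := ((hId (-δ) s hs).const_mul (1 / G)).add
      (hasDerivAt_fracInt hδ' hshift hV (fun r hr => (hd r hr).comp_const_add T r) hs)
    have heq : (fun s => ∫ x in (0:ℝ)..(T + s), f x) =ᶠ[𝓝 s]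
        (fun s => 1 / G * I (-δ) s) + fracInt (1 - δ) (fun s => F (T + s)) := by
      filter_upwards [Ioi_mem_nhds hs] with r hr
      have hr0 : (0:ℝ) < r := hr
      have hTr : 0 ≤ T + r := by linarith
      have h3 : ∫ x in (0:ℝ)..(T + r), f x = fracInt (1 - δ) F (T + r) := by
        rw [hF, fracInt_fracInt hδ' hδ hTr hf, sub_add_cancel, fracInt_one]
      rw [h3, fracInt_split hT (by linarith) (intervalIntegrable_kernel_mul hδ'
        (hFc.mono (by rw [uIcc_of_le hTr]; exact fun s hs => hs.1)))]
      simp only [Pi.add_apply, hI, add_sub_cancel_left, show 1 - δ - 1 = -δ by ring, hG]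
    have h4 := h1.unique (h2.congr_of_eventuallyEq heq)
    rw [h4, add_zero, show 1 - δ - 1 = -δ by ring]
    ring
  · intro s hs
    exact (((hId _ s hs).const_mul _).const_mul _).add
      ((Real.hasDerivAt_rpow_const (Or.inl hs.ne')).const_mul _)
  · refine ⟨|1 / G * (-δ * (-δ - 1))| * (∫ x in (0:ℝ)..T, |F x|) + |F T / G * -δ|, fun s hs => ?_⟩
    have hs0 : 0 < s := by linarith
    have h1 : |I (-δ - 1 - 1) s| ≤ s ^ (-δ - 1) * ∫ x in (0:ℝ)..T, |F x| := by
      have h2 := abs_integral_sub_rpow_mul_le (t := T + s) (r := -δ - 1 - 1) hT.le (by linarith)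
        (by linarith) hFi
      rw [add_sub_cancel_left] at h2
      refine h2.trans (mul_le_mul_of_nonneg_right ?_
        (intervalIntegral.integral_nonneg hT.le fun _ _ => abs_nonneg _))
      exact Real.rpow_le_rpow_of_exponent_le hs (by linarith)
    have h3 : 0 < s ^ (-δ - 1) := Real.rpow_pos_of_pos hs0 _
    calc |1 / G * (-δ * ((-δ - 1) * I (-δ - 1 - 1) s)) + F T / G * (-δ * s ^ (-δ - 1))|
        = |1 / G * (-δ * (-δ - 1)) * I (-δ - 1 - 1) s + F T / G * -δ * s ^ (-δ - 1)| := by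
          congr 1; ring
      _ ≤ |1 / G * (-δ * (-δ - 1))| * |I (-δ - 1 - 1) s| + |F T / G * -δ| * s ^ (-δ - 1) := by
          refine (abs_add_le _ _).trans ?_
          rw [abs_mul, abs_mul _ (s ^ _), abs_of_pos h3]
      _ ≤ |1 / G * (-δ * (-δ - 1))| * (s ^ (-δ - 1) * ∫ x in (0:ℝ)..T, |F x|)
          + |F T / G * -δ| * s ^ (-δ - 1) := by gcongr
      _ = _ := by ring

/-- Comparison principle for the Riemann–Liouville derivative of order `δ`, with the barrier
`-ε s ^ p + K s ^ (δ - 1)`. -/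
lemma exists_lt_barrier {δ p ε S₀ : ℝ} {V : ℝ → ℝ} (hδ : 0 < δ) (hδ1 : δ < 1) (hp : δ - 1 < p)
    (hS₀ : 0 < S₀) (hV : ContinuousOn V (Ici 0))
    (hstep : ∀ S ≥ S₀, -ε * S ^ p ≤ V S → ∃ κ > 0, ∃ r > 0, r < S ∧ ∀ s ∈ Icc r S, ∃ d ≤ -κ,
      HasDerivAt (fun s => fracInt (1 - δ) V s +
        ε * (Real.Gamma (p + 1) / Real.Gamma (1 - δ + p + 1) * s ^ (1 - δ + p))) d s) :
    ∃ K, ∀ s > 0, V s < -ε * s ^ p + K * s ^ (δ - 1) := by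
  have hδ' : 0 < 1 - δ := by linarith
  obtain ⟨K, hK0, hK⟩ : ∃ K ≥ 0, ∀ s ∈ Ioc 0 S₀, V s < -ε * s ^ p + K * s ^ (δ - 1) := by
    have hc : ContinuousOn (fun s => V s * s ^ (1 - δ) + ε * s ^ (1 - δ + p)) (Icc 0 S₀) := by
      refine ((hV.mono fun s hs => hs.1).mul ?_).add (continuousOn_const.mul ?_)
      · exact (Real.continuous_rpow_const hδ'.le).continuousOn
      · exact (Real.continuous_rpow_const (by linarith)).continuousOn
    obtain ⟨M, hM⟩ := isCompact_Icc.exists_bound_of_continuousOn hc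
    refine ⟨M + 1, by linarith [(norm_nonneg _).trans (hM S₀ ⟨hS₀.le, le_rfl⟩)], fun s hs => ?_⟩
    have h1 := (le_abs_self _).trans (hM s ⟨hs.1.le, hs.2⟩)
    have h2 : 0 < s ^ (δ - 1) := Real.rpow_pos_of_pos hs.1 _
    have h3 : s ^ (1 - δ) * s ^ (δ - 1) = 1 := by
      rw [← Real.rpow_add hs.1]; simp
    have h4 : s ^ (1 - δ + p) * s ^ (δ - 1) = s ^ p := by
      rw [← Real.rpow_add hs.1]; congr 1; ring
    have h5 : (V s * s ^ (1 - δ) + ε * s ^ (1 - δ + p)) * s ^ (δ - 1) = V s + ε * s ^ p := by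
      rw [add_mul, mul_assoc, mul_assoc, h3, h4, mul_one]
    have h6 : (V s * s ^ (1 - δ) + ε * s ^ (1 - δ + p)) * s ^ (δ - 1) < (M + 1) * s ^ (δ - 1) :=
      mul_lt_mul_of_pos_right (by linarith) h2
    linarith
  refine ⟨K, ?_⟩
  by_contra! hcon
  set φ : ℝ → ℝ := fun s => -ε * s ^ p + K * s ^ (δ - 1) with hφ
  have hφc : ContinuousOn φ (Ioi 0) := by
    have h : ∀ r : ℝ, ContinuousOn (fun s : ℝ => s ^ r) (Ioi 0) := fun r s hs =>
      (Real.continuousAt_rpow_const _ _ (Or.inl (ne_of_gt hs))).continuousWithinAt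
    exact (continuousOn_const.mul (h p)).add (continuousOn_const.mul (h _))
  have hzc : ContinuousOn (fun s => φ s - V s) (Ioi 0) := hφc.sub (hV.mono Ioi_subset_Ici_self)
  set E : Set ℝ := {s | S₀ ≤ s ∧ φ s - V s ≤ 0} with hE
  have hEne : E.Nonempty := by
    obtain ⟨s, hs, hle⟩ := hcon
    refine ⟨s, ?_, by simp only [hφ]; linarith⟩
    by_contra! h
    exact absurd (hK s ⟨hs, h.le⟩) (not_lt.2 hle)
  have hEclosed : IsClosed E := by
    have h1 : ContinuousOn (fun s => φ s - V s) (Ici S₀) :=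
      hzc.mono fun s hs => hS₀.trans_le hs
    have := h1.preimage_isClosed_of_isClosed isClosed_Ici isClosed_Iic (t := Iic 0)
    exact this
  have hEbdd : BddBelow E := ⟨S₀, fun s hs => hs.1⟩
  set S := sInf E with hS
  have hSE : S ∈ E := hEclosed.csInf_mem hEne hEbdd
  have hS0 : 0 < S := hS₀.trans_le hSE.1
  have hlt : ∀ s, 0 < s → s < S → 0 < φ s - V s := by
    intro s hs hsS
    by_contra! h
    rcases le_total s S₀ with h1 | h1
    · have := hK s ⟨hs, h1⟩
      simp only [hφ] at h
      linarith
    · exact absurd (csInf_le hEbdd (show s ∈ E from ⟨h1, h⟩)) (not_le.2 hsS)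
  have hzero : φ S - V S = 0 := by
    refine le_antisymm hSE.2 ?_
    have h1 : Tendsto (fun s => φ s - V s) (𝓝[<] S) (𝓝 (φ S - V S)) :=
      (hzc.continuousAt (Ioi_mem_nhds hS0)).tendsto.mono_left nhdsWithin_le_nhds
    refine ge_of_tendsto h1 ?_
    filter_upwards [Ioo_mem_nhdsLT hS0] with s hs using (hlt s hs.1 hs.2).le
  obtain ⟨κ, hκ, r, hr, hrS, hder⟩ := hstep S hSE.1 (by
    have : 0 ≤ K * S ^ (δ - 1) := mul_nonneg hK0 (Real.rpow_nonneg hS0.le _)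
    simp only [hφ] at hzero
    linarith)
  have hkerpow : ∀ q : ℝ, -1 < q → ∀ t > 0, IntervalIntegrable
      (fun s => (t - s) ^ (1 - δ - 1) * s ^ q) volume 0 t := by
    intro q hq t ht
    have h1 : IntervalIntegrable (fun s => (t - s) ^ (1 - δ - 1) * s ^ q) volume 0 (t / 2) := by
      refine (intervalIntegral.intervalIntegrable_rpow' hq).continuousOn_mul fun s hs => ?_
      rw [uIcc_of_le (by linarith)] at hs
      exact (ContinuousAt.rpow_const (by fun_prop) (Or.inl (by linarith [hs.2]))).continuousWithinAt
    refine h1.trans (intervalIntegrable_kernel_mul hδ' fun s hs => ?_)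
    rw [uIcc_of_le (by linarith)] at hs
    exact (Real.continuousAt_rpow_const _ _ (Or.inl (by linarith [hs.1]))).continuousWithinAt
  have hVi : ∀ t > 0, IntervalIntegrable (fun s => (t - s) ^ (1 - δ - 1) * V s) volume 0 t :=
    fun t ht => intervalIntegrable_kernel_mul hδ'
      (hV.mono (by rw [uIcc_of_le ht.le]; exact fun s hs => hs.1))
  have hexp : ∀ t, (fun s => (t - s) ^ (1 - δ - 1) * (φ s - V s)) = fun s =>
      -ε * ((t - s) ^ (1 - δ - 1) * s ^ p) + K * ((t - s) ^ (1 - δ - 1) * s ^ (δ - 1))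
        - (t - s) ^ (1 - δ - 1) * V s := by
    intro t; ext s; simp only [hφ]; ring
  have hint : ∀ t > 0, IntervalIntegrable (fun s => (t - s) ^ (1 - δ - 1) * (φ s - V s))
      volume 0 t := by
    intro t ht
    rw [hexp]
    exact (((hkerpow p (by linarith) t ht).const_mul _).add
      ((hkerpow (δ - 1) (by linarith) t ht).const_mul _)).sub (hVi t ht)
  have hform : ∀ t > 0, fracInt (1 - δ) (fun s => φ s - V s) t = K * Real.Gamma δ -
      (fracInt (1 - δ) V t +
        ε * (Real.Gamma (p + 1) / Real.Gamma (1 - δ + p + 1) * t ^ (1 - δ + p))) := by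
    intro t ht
    have h1 := fracInt_rpow hδ' (by linarith : -1 < p) ht
    have h2 := fracInt_rpow hδ' (by linarith : -1 < δ - 1) ht
    rw [show 1 - δ + (δ - 1) = 0 by ring, zero_add, Real.rpow_zero, Real.Gamma_one,
      sub_add_cancel, div_one, mul_one] at h2
    rw [← h1, ← h2]
    unfold fracInt
    rw [hexp, intervalIntegral.integral_sub (((hkerpow p (by linarith) t ht).const_mul _).add
      ((hkerpow (δ - 1) (by linarith) t ht).const_mul _)) (hVi t ht),
      intervalIntegral.integral_add ((hkerpow p (by linarith) t ht).const_mul _)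
      ((hkerpow (δ - 1) (by linarith) t ht).const_mul _), intervalIntegral.integral_const_mul,
      intervalIntegral.integral_const_mul]
    ring
  choose! d hd using hder
  refine fracInt_not_increasing_before_zero hδ' (by linarith) hr hrS hκ hzc hint
    (fun s hs => ?_) hzero fun s t hs hst ht => ?_
  · rcases hs.2.lt_or_eq with h | h
    · exact (hlt s hs.1 h).le
    · rw [h, hzero]
  · rw [hform t (by linarith), hform s (by linarith)]
    have := (convex_Icc r S).image_sub_le_mul_sub_of_deriv_le
      (f := fun s => fracInt (1 - δ) V s +
        ε * (Real.Gamma (p + 1) / Real.Gamma (1 - δ + p + 1) * s ^ (1 - δ + p))) (C := -κ)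
      (fun s hs => (hd s hs).2.continuousAt.continuousWithinAt)
      (fun s hs => (hd s (interior_subset hs)).2.differentiableAt.differentiableWithinAt)
      (fun s hs => by rw [(hd s (interior_subset hs)).2.deriv]; exact (hd s (interior_subset hs)).1)
      s ⟨hs, hst.trans ht⟩ t ⟨hs.trans hst, ht⟩ hst
    linarith

lemma isLittleO_rpow_rpow_atTop {r s : ℝ} (h : r < s) :
    (fun t : ℝ => t ^ r) =o[atTop] fun t : ℝ => t ^ s := by
  refine (Asymptotics.isLittleO_iff_tendsto' ?_).2 ?_
  · filter_upwards [eventually_gt_atTop 0] with t ht h0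
    exact absurd h0 (Real.rpow_pos_of_pos ht _).ne'
  · refine (tendsto_rpow_neg_atTop (sub_pos.2 h)).congr' ?_
    filter_upwards [eventually_gt_atTop 0] with t ht
    rw [← Real.rpow_sub ht]
    congr 1
    ring

/-- If `A = F + PA` and `B = I^δ F + PB` satisfy `A' + a B' ≤ -c t ^ p`, then `B` is eventually
differentiable and `B'` is bounded above by a negative multiple of `t ^ p`. -/
lemma eventually_deriv_le_of_fracInt {δ a c p T₀ : ℝ} {F A B PA PB : ℝ → ℝ} (hδ : 0 < δ)
    (hδ1 : δ < 1) (hp : δ - 1 < p) (hp0 : p < 0) (ha : 0 < a) (hc : 0 < c) (hT₀ : 0 ≤ T₀)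
    (hF : ContinuousOn F (Ici 0)) (hA : ∀ t > 0, A t = F t + PA t)
    (hB : ∀ t > 0, B t = fracInt δ F t + PB t)
    (hPA : ∀ t > 0, DifferentiableAt ℝ PA t) (hPB : ∀ t > 0, DifferentiableAt ℝ PB t)
    (hPAc : ContinuousOn (deriv PA) (Ioi 0)) (hPBc : ContinuousOn (deriv PB) (Ioi 0))
    (hPAo : deriv PA =o[atTop] fun t : ℝ => t ^ p) (hPBo : deriv PB =o[atTop] fun t : ℝ => t ^ p)
    (hAc : ContinuousOn (deriv A) (Ioi T₀)) (hBc : ContinuousOn (deriv B) (Ioi T₀))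
    (hineq : ∀ t > T₀, deriv A t + a * deriv B t ≤ -c * t ^ p) :
    ∃ c' > 0, ∀ᶠ t in atTop, DifferentiableAt ℝ B t ∧ deriv B t ≤ -c' * t ^ p := by
  have hFA : ∀ t > T₀, deriv A t ≠ 0 → HasDerivAt F (deriv A t - deriv PA t) t := by
    intro t ht hne
    have ht0 : 0 < t := hT₀.trans_lt ht
    refine ((differentiableAt_of_deriv_ne_zero hne).hasDerivAt.sub
      (hPA t ht0).hasDerivAt).congr_of_eventuallyEq ?_
    filter_upwards [Ioi_mem_nhds ht0] with s hs
    simp [hA s hs]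
  have hBd : ∀ t > T₀, DifferentiableAt ℝ B t := by
    intro t ht
    have ht0 : 0 < t := hT₀.trans_lt ht
    by_cases h0 : deriv A t = 0
    · refine differentiableAt_of_deriv_ne_zero fun hB0 => ?_
      have h1 := hineq t ht
      have h2 : 0 < c * t ^ p := mul_pos hc (Real.rpow_pos_of_pos ht0 _)
      rw [h0, hB0] at h1
      linarith
    · have hev : ∀ᶠ s in 𝓝 t, T₀ < s ∧ deriv A s ≠ 0 :=
        (eventually_gt_nhds ht).and ((hAc.continuousAt (Ioi_mem_nhds ht)).eventually_ne h0)
      obtain ⟨ε, hε, hball⟩ := Metric.eventually_nhds_iff_ball.1 hev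
      rw [Real.ball_eq_Ioo] at hball
      have hd := differentiableAt_fracInt hδ hF ht0 hε
        (fun s hs => hFA s (hball s hs).1 (hball s hs).2)
        ((hAc.mono fun s hs => (hball s hs).1).sub
          (hPAc.mono fun s hs => hT₀.trans_lt (hball s hs).1))
      refine (hd.add (hPB t ht0)).congr_of_eventuallyEq ?_
      filter_upwards [Ioi_mem_nhds ht0] with s hs using hB s hs
  have hI : ∀ t > T₀, HasDerivAt (fracInt δ F) (deriv B t - deriv PB t) t := by
    intro t ht
    have ht0 : 0 < t := hT₀.trans_lt ht
    refine ((hBd t ht).hasDerivAt.sub (hPB t ht0).hasDerivAt).congr_of_eventuallyEq ?_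
    filter_upwards [Ioi_mem_nhds ht0] with s hs
    simp [hB s hs]
  set T := T₀ + 1 with hT
  have hT0 : 0 < T := by linarith
  set V : ℝ → ℝ := fun s => deriv B (T + s) - deriv PB (T + s) with hV
  have hVc : ContinuousOn V (Ici 0) :=
    (hBc.comp (by fun_prop) fun s hs => by
      have : (0:ℝ) ≤ s := hs
      simp only [mem_Ioi]; linarith).sub
    (hPBc.comp (by fun_prop) fun s hs => by
      have : (0:ℝ) ≤ s := hs
      simp only [mem_Ioi]; linarith)
  obtain ⟨H, H', hdec, hH, C, hC⟩ := exists_history_decomposition (V := V) hδ hδ1 hT0 hF hVc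
    fun s hs => hI (T + s) (by linarith)
  set c₁ := c * 2 ^ p with hc₁
  have hc₁0 : 0 < c₁ := by positivity
  set ε := c₁ / (4 * a) with hε
  have hε0 : 0 < ε := by positivity
  have haε : a * ε = c₁ / 4 := by rw [hε]; field_simp
  set η := c₁ / (4 * (a + 3)) with hη
  have hη0 : 0 < η := by positivity
  have haη : (a + 3) * η = c₁ / 4 := by rw [hη]; field_simp
  set G := Real.Gamma (p + 1) / Real.Gamma (1 - δ + p + 1) with hG
  have hshift : Tendsto (fun s => T + s) atTop atTop := tendsto_atTop_add_const_left _ _ tendsto_id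
  have hest : ∀ᶠ s : ℝ in atTop, c₁ * s ^ p ≤ c * (T + s) ^ p ∧ |deriv PA (T + s)| ≤ η * s ^ p ∧
      |deriv PB (T + s)| ≤ η * s ^ p ∧ |H' s| ≤ η * s ^ p ∧
      ε * (G * ((1 - δ + p) * s ^ (1 - δ + p - 1))) ≤ η * s ^ p := by
    have hmono : ∀ s > 0, (T + s) ^ p ≤ s ^ p := fun s hs =>
      Real.rpow_le_rpow_of_nonpos hs (by linarith) hp0.le
    have hPAη := hshift.eventually (hPAo.bound hη0)
    have hPBη := hshift.eventually (hPBo.bound hη0)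
    have hHη := ((isLittleO_rpow_rpow_atTop
      (by linarith : -δ - 1 < p)).const_mul_left C).bound hη0
    have hGη := ((isLittleO_rpow_rpow_atTop
      (by linarith : 1 - δ + p - 1 < p)).const_mul_left (ε * (G * (1 - δ + p)))).bound hη0
    filter_upwards [hPAη, hPBη, hHη, hGη, eventually_ge_atTop 1, eventually_ge_atTop T]
      with s h1 h2 h3 h4 hs1 hsT
    have hs : 0 < s := by linarith
    have hn : ∀ r : ℝ, 0 < r → ‖r ^ p‖ = r ^ p := fun r hr =>
      Real.norm_of_nonneg (Real.rpow_nonneg hr.le _)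
    rw [hn _ (by linarith)] at h1 h2
    rw [hn _ hs] at h3 h4
    have hm := mul_le_mul_of_nonneg_left (hmono s hs) hη0.le
    refine ⟨?_, h1.trans hm, h2.trans hm, (hC s hs1).trans ((le_abs_self _).trans h3), ?_⟩
    · rw [hc₁, mul_assoc, ← Real.mul_rpow (by norm_num) hs.le]
      exact mul_le_mul_of_nonneg_left
        (Real.rpow_le_rpow_of_nonpos (by linarith) (by linarith) hp0.le) hc.le
    · refine le_trans (le_of_eq (by ring)) ((le_abs_self _).trans h4)
  obtain ⟨S₁, hS₁⟩ := eventually_atTop.1 hest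
  set S₂ := max S₁ 0 with hS₂
  have hmain : ∀ s > S₂, deriv A (T + s) ≤ -c₁ * s ^ p - a * V s + a * (η * s ^ p) := by
    intro s hs
    have hs0 : 0 < s := (le_max_right _ _).trans_lt hs
    obtain ⟨h1, -, h3, -, -⟩ := hS₁ s ((le_max_left _ _).trans hs.le)
    have h4 := hineq (T + s) (by linarith)
    have h5 := mul_le_mul_of_nonneg_left ((neg_le_abs _).trans h3) ha.le
    simp only [hV]
    linarith
  obtain ⟨K, hK⟩ := exists_lt_barrier (p := p) (ε := ε) (S₀ := S₂ + 1) hδ hδ1 hp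
    (by have := le_max_right S₁ 0; linarith) hVc (by
    intro S hS hVS
    have hS0 : 0 < S := by have := le_max_right S₁ 0; linarith
    have hSp : 0 < S ^ p := Real.rpow_pos_of_pos hS0 _
    have haV := mul_le_mul_of_nonneg_left hVS ha.le
    have hcont : ContinuousAt (fun s => 3 / 4 * c₁ * s ^ p + a * V s) S :=
      (continuousAt_const.mul (Real.continuousAt_rpow_const _ _ (Or.inl hS0.ne'))).add
        (continuousAt_const.mul (hVc.continuousAt (Ici_mem_nhds hS0)))
    have hval : 1 / 4 * c₁ * S ^ p < 3 / 4 * c₁ * S ^ p + a * V S := by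
      have : a * (-ε * S ^ p) = - (c₁ / 4) * S ^ p := by rw [← haε]; ring
      have : 0 < c₁ * S ^ p := by positivity
      linarith
    have hev := (hcont.eventually_const_lt hval).and (eventually_gt_nhds (by linarith : S₂ < S))
    obtain ⟨r, hr, hball⟩ := Metric.eventually_nhds_iff_ball.1 hev
    rw [Real.ball_eq_Ioo] at hball
    have hmr : 0 < min r S := lt_min hr hS0
    refine ⟨1 / 4 * c₁ * S ^ p, by positivity, S - min r S / 2,
      by linarith [min_le_right r S], by linarith, fun s hs => ?_⟩
    obtain ⟨hs1, hs2⟩ := hball s ⟨by linarith [min_le_left r S, hs.1], by linarith [hs.2]⟩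
    have hs2 : S₂ < s := hs2
    have hs0 : 0 < s := (le_max_right _ _).trans_lt hs2
    have hsp : 0 < s ^ p := Real.rpow_pos_of_pos hs0 _
    obtain ⟨-, h2, -, h4, h5⟩ := hS₁ s ((le_max_left _ _).trans hs2.le)
    have hm := hmain s hs2
    have haη' : a * (η * s ^ p) + 3 * (η * s ^ p) = c₁ / 4 * s ^ p := by rw [← haη]; ring
    have hηs : 0 < η * s ^ p := by positivity
    have hneg : deriv A (T + s) ≠ 0 := by
      have : 0 < c₁ * S ^ p := by positivity
      have : deriv A (T + s) < 0 := by linarith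
      exact this.ne
    refine ⟨deriv A (T + s) - deriv PA (T + s) - H' s
      + ε * (G * ((1 - δ + p) * s ^ (1 - δ + p - 1))), ?_, ?_⟩
    · have := neg_le_abs (deriv PA (T + s))
      have := neg_le_abs (H' s)
      linarith
    · have hd := (((hFA (T + s) (by linarith) hneg).comp_const_add T s).sub (hH s hs0)).add
        (((Real.hasDerivAt_rpow_const (p := 1 - δ + p) (Or.inl hs0.ne')).const_mul G).const_mul ε)
      refine hd.congr_of_eventuallyEq ?_
      filter_upwards [Ioi_mem_nhds hs0] with u hu
      simp [hdec u hu, hG])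
  refine ⟨ε / 2, by positivity, ?_⟩
  have hshift' : Tendsto (fun t => t - T) atTop atTop := tendsto_atTop_add_const_right _ _ tendsto_id
  have hKo := hshift'.eventually (((isLittleO_rpow_rpow_atTop hp).const_mul_left K).bound
    (by positivity : 0 < ε / 4))
  filter_upwards [hKo, hPBo.bound (by positivity : 0 < ε / 4), eventually_gt_atTop T]
    with t h1 h2 ht
  refine ⟨hBd t (by linarith), ?_⟩
  have hs : 0 < t - T := by linarith
  have h3 := hK (t - T) hs
  simp only [hV, add_sub_cancel] at h3
  rw [Real.norm_of_nonneg (Real.rpow_nonneg hs.le _)] at h1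
  rw [Real.norm_of_nonneg (Real.rpow_nonneg (by linarith) _)] at h2
  have h4 : t ^ p ≤ (t - T) ^ p := Real.rpow_le_rpow_of_nonpos hs (by linarith) hp0.le
  have h5 := mul_le_mul_of_nonneg_left h4 hε0.le
  have h6 := (le_abs_self _).trans h1
  have h7 := (le_abs_self _).trans h2
  linarith

lemma hasDerivAt_sum_rpow {N : ℕ} {c r : ℕ → ℝ} {t : ℝ} (ht : 0 < t) :
    HasDerivAt (fun t : ℝ => ∑ j ∈ Finset.range N, c j * t ^ r j)
      (∑ j ∈ Finset.range N, c j * (r j * t ^ (r j - 1))) t :=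
  HasDerivAt.fun_sum fun _ _ => (Real.hasDerivAt_rpow_const (Or.inl ht.ne')).const_mul _

lemma continuousOn_deriv_sum_rpow {N : ℕ} {c r : ℕ → ℝ} :
    ContinuousOn (deriv fun t : ℝ => ∑ j ∈ Finset.range N, c j * t ^ r j) (Ioi 0) := by
  have h : ContinuousOn (fun t : ℝ => ∑ j ∈ Finset.range N, c j * (r j * t ^ (r j - 1)))
      (Ioi 0) := by
    refine continuousOn_finsetSum _ fun j _ => continuousOn_const.mul (continuousOn_const.mul ?_)
    exact fun t ht => (Real.continuousAt_rpow_const _ _ (Or.inl (ne_of_gt ht))).continuousWithinAt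
  exact h.congr fun t ht => (hasDerivAt_sum_rpow ht).deriv

lemma isLittleO_deriv_sum_rpow {N : ℕ} {c r : ℕ → ℝ} {p : ℝ} (hr : ∀ j, r j - 1 < p) :
    (deriv fun t : ℝ => ∑ j ∈ Finset.range N, c j * t ^ r j) =o[atTop] fun t : ℝ => t ^ p := by
  have h : (fun t : ℝ => ∑ j ∈ Finset.range N, c j * (r j * t ^ (r j - 1)))
      =o[atTop] fun t : ℝ => t ^ p :=
    Asymptotics.IsLittleO.fun_sum fun j _ =>
      ((isLittleO_rpow_rpow_atTop (hr j)).const_mul_left _).const_mul_left _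
  refine h.congr' ?_ EventuallyEq.rfl
  filter_upwards [eventually_gt_atTop 0] with t ht using (hasDerivAt_sum_rpow ht).deriv.symm

lemma hasDerivAt_iteratedDerivWithin_Ici {m k : ℕ} {f : ℝ → ℝ} (hf : ContDiffOn ℝ m f (Ici 0))
    (hk : k < m) {s : ℝ} (hs : 0 < s) :
    HasDerivAt (iteratedDerivWithin k f (Ici 0)) (iteratedDerivWithin (k + 1) f (Ici 0) s) s := by
  have h := hf.differentiableOn_iteratedDerivWithin (by exact_mod_cast hk) (uniqueDiffOn_Ici 0)
    s hs.le
  rw [iteratedDerivWithin_succ]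
  exact h.hasDerivWithinAt.hasDerivAt (Ici_mem_nhds hs)

/-- Each derivation of `I^γ f` produces a boundary term which is a multiple of `t ^ (γ - 1)`. -/
lemma exists_hasDerivAt_of_eq_fracInt {γ : ℝ} {m k : ℕ} {f G : ℝ → ℝ} {c : ℕ → ℝ} (hγ : 0 < γ)
    (hf : ContDiffOn ℝ m f (Ici 0)) (hk : k < m)
    (hG : ∀ t > 0, G t = fracInt γ (iteratedDerivWithin k f (Ici 0)) t
      + ∑ j ∈ Finset.range k, c j * t ^ (γ - 1 - j)) :
    ∃ c' : ℕ → ℝ, ∀ t > 0, HasDerivAt G (fracInt γ (iteratedDerivWithin (k + 1) f (Ici 0)) t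
      + ∑ j ∈ Finset.range (k + 1), c' j * t ^ (γ - 1 - j)) t := by
  refine ⟨fun j => if j = 0 then iteratedDerivWithin k f (Ici 0) 0 / Real.Gamma γ
    else c (j - 1) * (γ - 1 - (j - 1 : ℕ)), fun t ht => ?_⟩
  have hcont : ∀ i ≤ m, ContinuousOn (iteratedDerivWithin i f (Ici 0)) (Ici 0) := fun i hi =>
    hf.continuousOn_iteratedDerivWithin (by exact_mod_cast hi) (uniqueDiffOn_Ici 0)
  have h1 := (hasDerivAt_fracInt hγ (hcont k hk.le) (hcont (k + 1) hk)
    (fun s hs => hasDerivAt_iteratedDerivWithin_Ici hf hk hs) ht).add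
    (hasDerivAt_sum_rpow (N := k) (c := c) (r := fun j => γ - 1 - j) ht)
  have h2 := h1.congr_of_eventuallyEq (f₁ := G) (by
    filter_upwards [Ioi_mem_nhds ht] with s hs using hG s hs)
  refine h2.congr_deriv ?_
  rw [Finset.sum_range_succ']
  have h3 : ∀ j : ℕ, γ - 1 - ((j + 1 : ℕ) : ℝ) = γ - 1 - j - 1 := fun j => by push_cast; ring
  simp only [h3, Nat.cast_zero, sub_zero, ← mul_assoc, if_true, Nat.succ_ne_zero, if_false,
    add_tsub_cancel_right]
  ring

lemma exists_iteratedDeriv_fracInt_eq {γ : ℝ} {m k : ℕ} {f : ℝ → ℝ} (hγ : 0 < γ)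
    (hf : ContDiffOn ℝ m f (Ici 0)) (hk : k ≤ m) :
    ∃ c : ℕ → ℝ, ∀ t > 0, iteratedDeriv k (fracInt γ f) t
      = fracInt γ (iteratedDerivWithin k f (Ici 0)) t
        + ∑ j ∈ Finset.range k, c j * t ^ (γ - 1 - j) := by
  induction k with
  | zero => exact ⟨0, fun t ht => by simp⟩
  | succ k ih =>
    obtain ⟨c, hc⟩ := ih (by omega)
    obtain ⟨c', hc'⟩ := exists_hasDerivAt_of_eq_fracInt hγ hf (by omega) hc
    exact ⟨c', fun t ht => by rw [iteratedDeriv_succ, (hc' t ht).deriv]⟩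

lemma differentiableAt_iteratedDeriv_fracInt {γ t : ℝ} {m k : ℕ} {f : ℝ → ℝ} (hγ : 0 < γ)
    (hf : ContDiffOn ℝ m f (Ici 0)) (hk : k < m) (ht : 0 < t) :
    DifferentiableAt ℝ (iteratedDeriv k (fracInt γ f)) t := by
  obtain ⟨c, hc⟩ := exists_iteratedDeriv_fracInt_eq hγ hf hk.le
  obtain ⟨c', hc'⟩ := exists_hasDerivAt_of_eq_fracInt hγ hf hk hc
  exact (hc' t ht).differentiableAt

lemma eventually_le_of_deriv_le {c r : ℝ} {f : ℝ → ℝ} (hc : 0 < c) (hr : -1 < r)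
    (h : ∀ᶠ t in atTop, DifferentiableAt ℝ f t ∧ deriv f t ≤ -c * t ^ r) :
    ∃ c' > 0, ∀ᶠ t in atTop, f t ≤ -c' * t ^ (r + 1) := by
  have hr' : 0 < r + 1 := by linarith
  obtain ⟨T, hT⟩ := eventually_atTop.1 (h.and (eventually_gt_atTop 0))
  have hd : ∀ t ≥ T, HasDerivAt (fun t => f t + c / (r + 1) * t ^ (r + 1))
      (deriv f t + c / (r + 1) * ((r + 1) * t ^ (r + 1 - 1))) t := fun t ht =>
    (hT t ht).1.1.hasDerivAt.add
      ((Real.hasDerivAt_rpow_const (Or.inl (hT t ht).2.ne')).const_mul _)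
  have hanti : AntitoneOn (fun t => f t + c / (r + 1) * t ^ (r + 1)) (Ici T) := by
    refine antitoneOn_of_deriv_nonpos (convex_Ici T)
      (fun t ht => (hd t ht).continuousAt.continuousWithinAt)
      (fun t ht => (hd t (interior_subset ht)).differentiableAt.differentiableWithinAt)
      fun t ht => ?_
    have ht' := interior_subset ht
    rw [(hd t ht').deriv, add_sub_cancel_right, ← mul_assoc, div_mul_cancel₀ _ hr'.ne']
    linarith [(hT t ht').1.2]
  refine ⟨c / (r + 1) / 2, by positivity, ?_⟩
  filter_upwards [eventually_ge_atTop T, ((tendsto_rpow_atTop hr').const_mul_atTop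
    (by positivity : 0 < c / (r + 1) / 2)).eventually_ge_atTop
      (f T + c / (r + 1) * T ^ (r + 1))] with t ht h1
  have h2 := hanti (mem_Ici.2 le_rfl) (mem_Ici.2 ht) ht
  simp only at h2
  linarith

lemma eventually_le_of_iteratedDeriv_le {c r : ℝ} {m : ℕ} {f : ℝ → ℝ} (hc : 0 < c) (hr : -1 < r)
    (hd : ∀ k < m, ∀ᶠ t in atTop, DifferentiableAt ℝ (iteratedDeriv k f) t)
    (h : ∀ᶠ t in atTop, iteratedDeriv m f t ≤ -c * t ^ r) :
    ∃ c' > 0, ∀ᶠ t in atTop, f t ≤ -c' * t ^ (r + m) := by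
  induction m generalizing c r with
  | zero => exact ⟨c, hc, by simpa using h⟩
  | succ m ih =>
    obtain ⟨c', hc', h'⟩ := eventually_le_of_deriv_le (f := iteratedDeriv m f) hc hr (by
      rw [iteratedDeriv_succ] at h
      exact (hd m (by omega)).and h)
    obtain ⟨c'', hc'', h''⟩ := ih hc' (by linarith) (fun k hk => hd k (by omega)) h'
    refine ⟨c'', hc'', ?_⟩
    rwa [add_right_comm, add_assoc, ← Nat.cast_succ] at h''

lemma le_fracInt {γ M t : ℝ} {f : ℝ → ℝ} (hγ : 0 < γ) (ht : 0 ≤ t) (hf : ContinuousOn f (Ici 0))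
    (h : ∀ s ∈ Icc 0 t, M ≤ f s) : M * t ^ γ / Real.Gamma (γ + 1) ≤ fracInt γ f t := by
  rw [← fracInt_const hγ]
  unfold fracInt
  refine mul_le_mul_of_nonneg_left (intervalIntegral.integral_mono_on ht
    (intervalIntegrable_kernel_mul hγ continuousOn_const)
    (intervalIntegrable_kernel_mul hγ (hf.mono ?_)) fun s hs =>
      mul_le_mul_of_nonneg_left (h s hs) (Real.rpow_nonneg (by linarith [hs.2]) _))
    (one_div_nonneg.2 (Real.Gamma_pos_of_pos hγ).le)
  rw [uIcc_of_le ht]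
  exact fun s hs => hs.1

lemma exists_le_fracInt_sub_polynomial {γ T : ℝ} {m : ℕ} {x : ℝ → ℝ} {b : ℕ → ℝ} (hγ : 0 < γ)
    (hx : ContinuousOn x (Ici 0)) (hpos : ∀ t ≥ T, 0 < x t) :
    ∃ C, ∀ t ≥ 1, -C * t ^ (m + γ)
      ≤ fracInt γ (fun s => x s - ∑ k ∈ Finset.range (m + 1), b k * s ^ k) t := by
  obtain ⟨M, hM⟩ := (isCompact_Icc (a := 0) (b := T)).exists_bound_of_continuousOn
    (hx.mono fun s hs => hs.1)
  set D := |M| + ∑ k ∈ Finset.range (m + 1), |b k| with hD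
  have hD0 : 0 ≤ D := add_nonneg (abs_nonneg _) (Finset.sum_nonneg fun _ _ => abs_nonneg _)
  have hlow : ∀ s ≥ 0, -(D * (1 + s) ^ m) ≤ x s - ∑ k ∈ Finset.range (m + 1), b k * s ^ k := by
    intro s hs
    have h1 : 1 ≤ (1 + s) ^ m := one_le_pow₀ (by linarith)
    have h2 : ∑ k ∈ Finset.range (m + 1), b k * s ^ k
        ≤ (∑ k ∈ Finset.range (m + 1), |b k|) * (1 + s) ^ m := by
      rw [Finset.sum_mul]
      refine Finset.sum_le_sum fun k hk => ?_
      have hk : k ≤ m := by simpa [Nat.lt_succ_iff] using hk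
      calc b k * s ^ k ≤ |b k| * s ^ k :=
            mul_le_mul_of_nonneg_right (le_abs_self _) (by positivity)
        _ ≤ |b k| * (1 + s) ^ m := by
            refine mul_le_mul_of_nonneg_left ?_ (abs_nonneg _)
            exact (pow_le_pow_left₀ hs (by linarith) k).trans
              (pow_le_pow_right₀ (by linarith) hk)
    have h3 : -|M| ≤ x s := by
      rcases le_total s T with h | h
      · have h4 := hM s ⟨hs, h⟩
        rw [Real.norm_eq_abs] at h4
        linarith [neg_abs_le (x s), le_abs_self M]
      · linarith [hpos s h, abs_nonneg M]
    have h4 := mul_le_mul_of_nonneg_left h1 (abs_nonneg M)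
    rw [hD, add_mul]
    linarith
  refine ⟨D * 2 ^ m / Real.Gamma (γ + 1), fun t ht => ?_⟩
  have ht0 : 0 < t := by linarith
  refine le_trans ?_ (le_fracInt (M := -(D * (1 + t) ^ m)) hγ ht0.le ?_ fun s hs => ?_)
  · rw [Real.rpow_add ht0, Real.rpow_natCast, neg_mul, neg_mul, neg_div, neg_le_neg_iff,
      div_mul_eq_mul_div]
    refine div_le_div_of_nonneg_right ?_ (Real.Gamma_pos_of_pos (by linarith)).le
    rw [← mul_assoc (D * 2 ^ m), mul_assoc D (2 ^ m), ← mul_pow]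
    refine mul_le_mul_of_nonneg_right (mul_le_mul_of_nonneg_left ?_ hD0)
      (Real.rpow_nonneg ht0.le _)
    exact pow_le_pow_left₀ (by linarith) (by linarith) m
  · exact hx.sub (by fun_prop)
  · refine le_trans (neg_le_neg (mul_le_mul_of_nonneg_left ?_ hD0)) (hlow s hs.1)
    exact pow_le_pow_left₀ (by linarith [hs.1]) (by linarith [hs.2]) m

lemma caputoD_eq_deriv {γ : ℝ} {m : ℕ} {x : ℝ → ℝ} (h : ⌈γ⌉₊ = m + 1) :
    caputoD γ x = deriv (iteratedDeriv m
      (fracInt (((m + 1 : ℕ) : ℝ) - γ) fun s => x s - taylorPolyAt0 (m + 1) x s)) := by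
  unfold caputoD
  rw [h, iteratedDeriv_succ]

lemma fracInt_zero_left {f : ℝ → ℝ} : fracInt 0 f = 0 := by
  ext t
  simp [fracInt, Real.Gamma_zero]

/-- A differential inequality `ᶜD^α x + a ᶜD^β x ≤ -c t ^ p` with `p > ⌈α⌉ - β - 1` forces the
top-order derivative defining `ᶜD^β x` to decay at least like `-c' t ^ p`. -/
lemma eventually_caputoD_le {α β a c p T₀ : ℝ} {m : ℕ} {x : ℝ → ℝ} (hα : α ≤ (m + 1 : ℕ))
    (hmβ : (m : ℝ) < β) (hβα : β < α) (hp : ((m + 1 : ℕ) : ℝ) - β - 1 < p) (hp0 : p < 0)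
    (ha : 0 < a) (hc : 0 < c) (hT₀ : 0 ≤ T₀) (hx : ContDiffOn ℝ m x (Ici 0))
    (hαc : ContinuousOn (caputoD α x) (Ioi T₀)) (hβc : ContinuousOn (caputoD β x) (Ioi T₀))
    (hineq : ∀ t > T₀, caputoD α x t + a * caputoD β x t ≤ -c * t ^ p) :
    ∃ c' > 0, ∀ᶠ t in atTop, DifferentiableAt ℝ (iteratedDeriv m
      (fracInt (((m + 1 : ℕ) : ℝ) - β) fun s => x s - taylorPolyAt0 (m + 1) x s)) t ∧
        caputoD β x t ≤ -c' * t ^ p := by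
  have hceilα : ⌈α⌉₊ = m + 1 :=
    (Nat.ceil_eq_iff (Nat.succ_ne_zero m)).2 ⟨by simpa using hmβ.trans hβα, hα⟩
  have hceilβ : ⌈β⌉₊ = m + 1 :=
    (Nat.ceil_eq_iff (Nat.succ_ne_zero m)).2 ⟨by simpa using hmβ, hβα.le.trans hα⟩
  rw [caputoD_eq_deriv hceilα] at hαc hineq
  rw [caputoD_eq_deriv hceilβ] at hβc hineq ⊢
  set φ : ℝ → ℝ := fun s => x s - taylorPolyAt0 (m + 1) x s with hφ
  have hφm : ContDiffOn ℝ m φ (Ici 0) := by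
    refine hx.sub (ContDiff.contDiffOn ?_)
    unfold taylorPolyAt0
    fun_prop
  push_cast at hα hp hαc hβc hineq ⊢
  rcases hα.lt_or_eq with hlt | heq
  · have hθ : 0 < (m : ℝ) + 1 - α := by linarith
    have hδ : 0 < α - β := by linarith
    have hβθ : (m : ℝ) + 1 - β = α - β + (m + 1 - α) := by ring
    obtain ⟨cA, hA⟩ := exists_iteratedDeriv_fracInt_eq hθ hφm le_rfl
    obtain ⟨cB, hB⟩ := exists_iteratedDeriv_fracInt_eq (by linarith : 0 < (m : ℝ) + 1 - β)
      hφm le_rfl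
    have hh : ContinuousOn (iteratedDerivWithin m φ (Ici 0)) (Ici 0) :=
      hφm.continuousOn_iteratedDerivWithin le_rfl (uniqueDiffOn_Ici 0)
    refine eventually_deriv_le_of_fracInt hδ (by linarith) (by linarith) hp0 ha hc hT₀
      (continuousOn_fracInt hθ hh) hA (fun t ht => ?_)
      (fun t ht => (hasDerivAt_sum_rpow (c := cA) ht).differentiableAt)
      (fun t ht => (hasDerivAt_sum_rpow (N := m) (c := cB)
        (r := fun j => (m : ℝ) + 1 - β - 1 - j) ht).differentiableAt)
      continuousOn_deriv_sum_rpow continuousOn_deriv_sum_rpow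
      (isLittleO_deriv_sum_rpow fun j => ?_) (isLittleO_deriv_sum_rpow fun j => ?_) hαc hβc hineq
    · rw [fracInt_fracInt hδ hθ ht.le hh, ← hβθ]
      exact hB t ht
    · have : (0:ℝ) ≤ j := j.cast_nonneg
      linarith
    · have : (0:ℝ) ≤ j := j.cast_nonneg
      linarith
  · have h0 : deriv (iteratedDeriv m (fracInt ((m : ℝ) + 1 - α) φ)) = 0 := by
      rw [heq, sub_self, fracInt_zero_left, ← iteratedDeriv_succ]
      ext t
      simp
    refine ⟨c / a, by positivity, ?_⟩
    filter_upwards [eventually_gt_atTop T₀] with t ht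
    have h1 := hineq t ht
    rw [h0, Pi.zero_apply, zero_add] at h1
    have h2 : 0 < c * t ^ p := mul_pos hc (Real.rpow_pos_of_pos (hT₀.trans_lt ht) _)
    refine ⟨differentiableAt_of_deriv_ne_zero fun h => ?_, ?_⟩
    · rw [h] at h1
      linarith
    · rw [← neg_div, div_mul_eq_mul_div, le_div_iff₀ ha]
      linarith

lemma false_of_caputoD_add_le {α β a c p T₀ : ℝ} {m : ℕ} {x : ℝ → ℝ} (hα : α ≤ (m + 1 : ℕ))
    (hmβ : (m : ℝ) < β) (hβα : β < α) (hp : ((m + 1 : ℕ) : ℝ) - β - 1 < p) (hp0 : p < 0)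
    (ha : 0 < a) (hc : 0 < c) (hT₀ : 0 ≤ T₀) (hx : ContDiffOn ℝ m x (Ici 0))
    (hαc : ContinuousOn (caputoD α x) (Ioi T₀)) (hβc : ContinuousOn (caputoD β x) (Ioi T₀))
    (hineq : ∀ t > T₀, caputoD α x t + a * caputoD β x t ≤ -c * t ^ p)
    (hpos : ∀ t ≥ T₀, 0 < x t) : False := by
  obtain ⟨c', hc', h1⟩ :=
    eventually_caputoD_le hα hmβ hβα hp hp0 ha hc hT₀ hx hαc hβc hineq
  have hceilβ : ⌈β⌉₊ = m + 1 :=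
    (Nat.ceil_eq_iff (Nat.succ_ne_zero m)).2 ⟨by simpa using hmβ, hβα.le.trans hα⟩
  have hν : 0 < ((m + 1 : ℕ) : ℝ) - β := by linarith
  have hφm : ContDiffOn ℝ m (fun s => x s - taylorPolyAt0 (m + 1) x s) (Ici 0) := by
    refine hx.sub (ContDiff.contDiffOn ?_)
    unfold taylorPolyAt0
    fun_prop
  rw [caputoD_eq_deriv hceilβ, ← iteratedDeriv_succ] at h1
  obtain ⟨c'', hc'', h2⟩ := eventually_le_of_iteratedDeriv_le (m := m + 1) hc'
    (by push_cast at hp hν; linarith : -1 < p) (fun k hk => by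
      rcases (Nat.lt_succ_iff.1 hk).lt_or_eq with h | rfl
      · filter_upwards [eventually_gt_atTop 0] with t ht using
          differentiableAt_iteratedDeriv_fracInt hν hφm h ht
      · exact h1.mono fun t ht => ht.1) (h1.mono fun t ht => ht.2)
  obtain ⟨C, hC⟩ := exists_le_fracInt_sub_polynomial (m := m)
    (b := fun k => iteratedDeriv k x 0 / (Nat.factorial k : ℝ)) hν hx.continuousOn hpos
  have h3 := ((isLittleO_rpow_rpow_atTop (r := m + (((m + 1 : ℕ) : ℝ) - β))
    (s := p + ((m + 1 : ℕ) : ℝ)) (by push_cast at hp ⊢; linarith)).const_mul_left C).bound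
    (by positivity : 0 < c'' / 2)
  obtain ⟨t, h2t, h3t, ht⟩ := (h2.and (h3.and (eventually_ge_atTop 1))).exists
  have h4 := hC t ht
  have h5 : 0 < t ^ (p + ((m + 1 : ℕ) : ℝ)) := Real.rpow_pos_of_pos (by linarith) _
  rw [Real.norm_of_nonneg h5.le] at h3t
  have h6 := (le_abs_self _).trans h3t
  have h7 := h4.trans h2t
  have h8 : 0 < c'' * t ^ (p + ((m + 1 : ℕ) : ℝ)) := by positivity
  linarith

/-- sign patterns of the associated functions of an eventually
positive solution. -/
theorem stmt17
    (n : ℕ) (hn3 : 3 ≤ n)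
    (α β a : ℝ)
    (hβ : (n : ℝ) - 1 < β) (hβα : β < α) (hceil : ⌈α⌉₊ = n)
    (ha : 0 < a)
    (f : ℝ → ℝ) (q g : ℝ → ℝ)
    (hfc : Continuous f) (hqc : ContinuousOn q (Set.Ici 0))
    (hgc : ContinuousOn g (Set.Ici 0))
    (hG1 : ∀ u : ℝ, u ≠ 0 → 0 < u * f u)
    (hG2 : ∃ c₁ > (0:ℝ), ∃ η > (0:ℝ), ∀ u : ℝ, 1 ≤ |u| → c₁ * |u| ^ η ≤ |f u|)
    (hH : ∃ T₁ > (0:ℝ), ∃ c₃ > (0:ℝ), ∀ t ≥ T₁, c₃ ≤ q t)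
    (hK : ∃ σ : ℝ, (n : ℝ) - β < σ ∧ σ < 1 ∧
      ∃ c₄ > (0:ℝ), ∃ T₂ > (0:ℝ), ∀ t ≥ T₂, c₄ * t ^ ((n : ℝ) - β - σ) ≤ g t)
    (ξ : ℕ → ℝ) (x : ℝ → ℝ)
    (hx : ContCaputoDiffOnIci α x)
    (heq : ∀ t > (0:ℝ),
      caputoD α x t + a * caputoD β x t + q t * f (x t) + Real.sign (x t) * g t = 0)
    (hinit : ∀ i < n, iteratedDeriv i x 0 = ξ i)
    (hxpos : ∃ T > (0:ℝ), ∀ t ≥ T, 0 < x t) :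
    (Odd n → ∃ T > (0:ℝ), ∀ t ≥ T, ∀ i, 1 ≤ i → i ≤ n →
      0 < (-1 : ℝ) ^ (i + 1) * assocY n α β a ξ x i t) ∧
    (Even n → ∃ T > (0:ℝ),
      (∀ t ≥ T, ∀ i, 1 ≤ i → i ≤ n → 0 < (-1 : ℝ) ^ i * assocY n α β a ξ x i t) ∨
      (∀ t ≥ T, 0 < assocY n α β a ξ x 1 t ∧ 0 < assocY n α β a ξ x 2 t ∧
        ∀ i, 3 ≤ i → i ≤ n → 0 < (-1 : ℝ) ^ i * assocY n α β a ξ x i t)) := by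
  exfalso
  obtain ⟨m, rfl⟩ : ∃ m, n = m + 1 := ⟨n - 1, by omega⟩
  obtain ⟨σ, hσ, hσ1, c₄, hc₄, T₂, hT₂, hg⟩ := hK
  obtain ⟨T₁, hT₁, c₃, hc₃, hq⟩ := hH
  obtain ⟨T, hT, hpos⟩ := hxpos
  have hα : α ≤ (m + 1 : ℕ) := hceil ▸ Nat.le_ceil α
  have hmβ : (m : ℝ) < β := by push_cast at hβ; linarith
  obtain ⟨hxm, hxc⟩ := hx
  rw [hceil, Nat.add_sub_cancel] at hxm
  set T₀ := T + T₁ + T₂ with hT₀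
  have hfpos : ∀ t ≥ T₀, 0 < f (x t) := fun t ht => by
    have hxt := hpos t (by linarith)
    exact pos_of_mul_pos_right (hG1 _ hxt.ne') hxt.le
  have hsum : ∀ t > T₀, caputoD α x t + a * caputoD β x t = -(q t * f (x t) + g t) := by
    intro t ht
    have h := heq t (by linarith)
    rw [Real.sign_of_pos (hpos t (by linarith)), one_mul] at h
    linarith
  have hsub : Ioi T₀ ⊆ Ici 0 := fun t ht => by
    have : T₀ < t := ht
    exact mem_Ici.2 (by linarith)
  refine false_of_caputoD_add_le (p := ((m + 1 : ℕ) : ℝ) - β - σ) (T₀ := T₀) hα hmβ hβα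
    (by linarith) (by linarith) ha hc₄ (by linarith) hxm (hxc.mono hsub) ?_ (fun t ht => ?_)
    fun t ht => hpos t (by linarith)
  · have hc : ContinuousOn (fun t => (-(q t * f (x t) + g t) - caputoD α x t) / a) (Ioi T₀) :=
      ((((hqc.mul (hfc.comp_continuousOn hxm.continuousOn)).add hgc).neg.sub hxc).div_const
        a).mono hsub
    refine hc.congr fun t ht => ?_
    rw [eq_div_iff ha.ne', ← hsum t ht]
    ring
  · rw [hsum t ht]
    have h1 : 0 < q t * f (x t) :=
      mul_pos (hc₃.trans_le (hq t (by linarith))) (hfpos t ht.le)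
    have h2 := hg t (by linarith)
    linarith
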